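/- arXiv:1208.4447 — 2 statements merged into one kernel-verified Lean document; each statement's English description precedes it below -/
import Mathlib

section
/- Let (R, m) be a Noetherian local ring, a an ideal, and M a finitely generated R-module of dimension d. Then H^d_a(M) is a homomorphic image of the top local cohomology module H^d_m(M); in particular there is a surjection H^d_m(M) ↠ H^d_a(M). -/
open CategoryTheory CategoryTheory.Limits DirectSum TensorProduct

universe u

/-- The Krull dimension of a module: `sup {dim R/p | p ∈ Supp M}`. -/
noncomputable def moduleDim (R : Type u) [CommRing R] (M : Type u) [AddCommGroup M]
    [Module R M] : WithBot ℕ∞ :=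
  ⨆ p ∈ Module.support R M, ringKrullDim (R ⧸ p.asIdeal)

/-- `Assh R M`: the primes `p` in the support of `M` with `dim R/p = dim M`. -/
noncomputable def asshIdeals (R : Type u) [CommRing R] (M : Type u) [AddCommGroup M]
    [Module R M] : Set (Ideal R) :=
  {p | ∃ hp : p.IsPrime, (⟨p, hp⟩ : PrimeSpectrum R) ∈ Module.support R M ∧
    ringKrullDim (R ⧸ p) = moduleDim R M}

namespace LCSurj

open Opposite

section Bridge

variable {R : Type u} [CommRing R]

/-- The functor `Hom(-, Y)`, valued in the opposite category of modules. -/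
noncomputable abbrev homF (Y : ModuleCat.{u} R) : ModuleCat.{u} R ⥤ (ModuleCat.{u} R)ᵒᵖ :=
  ((linearYoneda R (ModuleCat.{u} R)).obj Y).rightOp

/-- The complex `Hom(P, Y)` in the opposite category of modules. -/
noncomputable abbrev homK (Y : ModuleCat.{u} R) (P : ChainComplex (ModuleCat.{u} R) ℕ) :
    ChainComplex (ModuleCat.{u} R)ᵒᵖ ℕ :=
  ((homF Y).mapHomologicalComplex _).obj P

/-- `ξ` is represented by the cocycle `f`. -/
def Rel {X Y : ModuleCat.{u} R} (P : ProjectiveResolution X) (n : ℕ) (f : P.complex.X n ⟶ Y)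
    (ξ : ((Ext R (ModuleCat.{u} R) n).obj (op X)).obj Y) : Prop :=
  ∃ z : ((homK Y P.complex).opcycles n).unop,
    ((homK Y P.complex).pOpcycles n).unop.hom z = f ∧
    (P.isoLeftDerivedObj (homF Y) n).hom.unop.hom
      (((homK Y P.complex).homologyι n).unop.hom z) = ξ

lemma rel_surj {X Y : ModuleCat.{u} R} (P : ProjectiveResolution X) (n : ℕ)
    (ξ : ((Ext R (ModuleCat.{u} R) n).obj (op X)).obj Y) :
    ∃ f : P.complex.X n ⟶ Y, P.complex.d (n+1) n ≫ f = 0 ∧ Rel P n f ξ := by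
  have h1 : Function.Surjective ((homK Y P.complex).homologyι n).unop.hom :=
    (ModuleCat.epi_iff_surjective _).1 inferInstance
  have h2 : Function.Surjective (P.isoLeftDerivedObj (homF Y) n).hom.unop.hom :=
    (ModuleCat.epi_iff_surjective _).1 inferInstance
  obtain ⟨w, hw⟩ := h2 ξ
  obtain ⟨z, hz⟩ := h1 w
  refine ⟨((homK Y P.complex).pOpcycles n).unop.hom z, ?_, z, rfl, ?_⟩
  · have := (homK Y P.complex).d_pOpcycles (n+1) n
    have := congrArg (fun q => q.unop.hom z) this
    exact this
  · rw [hz, hw]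

lemma rel_exists {X Y : ModuleCat.{u} R} (P : ProjectiveResolution X) (n : ℕ)
    (f : P.complex.X n ⟶ Y) (hf : P.complex.d (n+1) n ≫ f = 0) :
    ∃ ξ, Rel P n f ξ := by
  let K := homK Y P.complex
  let k : K.X n ⟶ op (ModuleCat.of R R) :=
    Quiver.Hom.op (ModuleCat.ofHom (LinearMap.toSpanSingleton R (P.complex.X n ⟶ Y) f))
  have hk : K.d (n+1) n ≫ k = 0 := by
    apply Quiver.Hom.unop_inj
    apply ModuleCat.hom_ext
    apply LinearMap.ext_ring
    change P.complex.d (n+1) n ≫ ((1 : R) • f) = 0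
    simp [hf]
  let e := K.descOpcycles k (n+1) (by simp) hk
  have he : K.pOpcycles n ≫ e = k := K.p_descOpcycles _ _ _ _
  refine ⟨_, e.unop.hom (1 : R), ?_, rfl⟩
  have := congrArg (fun q => q.unop.hom (1 : R)) he
  refine this.trans ?_
  change (1 : R) • f = f
  simp

lemma rel_unique {X Y : ModuleCat.{u} R} (P : ProjectiveResolution X) (n : ℕ)
    {f g : P.complex.X n ⟶ Y} {ξ ζ : ((Ext R (ModuleCat.{u} R) n).obj (op X)).obj Y}
    (h1 : Rel P n f ξ) (h2 : Rel P n g ζ)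
    (hfg : f = g ∨ ∃ p, p + 1 = n ∧ ∃ l : P.complex.X p ⟶ Y, P.complex.d n p ≫ l = f - g) :
    ξ = ζ := by
  obtain ⟨z, hz, rfl⟩ := h1
  obtain ⟨w, hw, rfl⟩ := h2
  have hinj : Function.Injective ((homK Y P.complex).pOpcycles n).unop.hom :=
    (ModuleCat.mono_iff_injective _).1 inferInstance
  rcases hfg with rfl | ⟨p, hp, l, hl⟩
  · rw [hinj (hz.trans hw.symm)]
  · have h3 : z - w = ((homK Y P.complex).fromOpcycles n p).unop.hom l := by
      apply hinj
      rw [map_sub, hz, hw]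
      have := (homK Y P.complex).p_fromOpcycles n p
      have := congrArg (fun q => q.unop.hom l) this
      exact (this.trans hl).symm
    have := (homK Y P.complex).homologyι_comp_fromOpcycles n p
    have := congrArg (fun q => q.unop.hom l) this
    have h4 : ((homK Y P.complex).homologyι n).unop.hom
      (((homK Y P.complex).fromOpcycles n p).unop.hom l) = 0 := this
    rw [← h3, map_sub, sub_eq_zero] at h4
    exact congrArg (P.isoLeftDerivedObj (homF Y) n).hom.unop.hom h4

lemma rel_map {X X' Y : ModuleCat.{u} R} {P : ProjectiveResolution X}
    {P' : ProjectiveResolution X'} (g : X' ⟶ X) (φ : ProjectiveResolution.Hom P' P g) (n : ℕ)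
    {f : P.complex.X n ⟶ Y} {ξ : ((Ext R (ModuleCat.{u} R) n).obj (op X)).obj Y}
    (h : Rel P n f ξ) :
    Rel P' n (φ.hom.f n ≫ f) ((((Ext R (ModuleCat.{u} R) n).map g.op).app Y).hom ξ) := by
  obtain ⟨z, rfl, rfl⟩ := h
  let ψ := ((homF Y).mapHomologicalComplex (ComplexShape.down ℕ)).map φ.hom
  refine ⟨(HomologicalComplex.opcyclesMap ψ n).unop.hom z, ?_, ?_⟩
  · have := HomologicalComplex.p_opcyclesMap ψ n
    exact congrArg (fun q => q.unop.hom z) this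
  · have h1 := HomologicalComplex.homologyι_naturality ψ n
    have h1 := congrArg (fun q => q.unop.hom z) h1
    have h2 := ProjectiveResolution.isoLeftDerivedObj_hom_naturality g P' P φ.hom
      (by exact φ.hom_f_zero_comp_π_f_zero) (homF Y) n
    have h2 := congrArg (fun q => q.unop.hom
      (((homK Y P.complex).homologyι n).unop.hom z)) h2
    refine Eq.trans ?_ h2.symm
    exact congrArg (P'.isoLeftDerivedObj (homF Y) n).hom.unop.hom h1.symm

lemma extMk_eq {X Y : ModuleCat.{u} R} (P : ProjectiveResolution X) (n : ℕ)
    (f g : P.complex.X n ⟶ Y) (hf : P.complex.d (n+1) n ≫ f = 0)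
    (hg : P.complex.d (n+1) n ≫ g = 0)
    (h : P.extMk f (n+1) rfl hf = P.extMk g (n+1) rfl hg) :
    f = g ∨ ∃ p, p + 1 = n ∧ ∃ l : P.complex.X p ⟶ Y, P.complex.d n p ≫ l = f - g := by
  rw [← sub_eq_zero, ProjectiveResolution.sub_extMk] at h
  cases n with
  | succ p =>
    right
    exact ⟨p, rfl, (P.extMk_eq_zero_iff _ _ _ _ p rfl).1 h⟩
  | zero =>
    left
    rw [← sub_eq_zero]
    have h := congrArg P.extEquivCohomologyClass h
    rw [ProjectiveResolution.extEquivCohomologyClass_extMk,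
      ProjectiveResolution.extEquivCohomologyClass_zero,
      CochainComplex.HomComplex.CohomologyClass.mk_eq_zero_iff,
      CochainComplex.HomComplex.Cocycle.toSingleMk_mem_coboundaries_iff _ _ _ _ _ 1 (by simp)] at h
    obtain ⟨l, hl⟩ := h
    have h0 : P.cochainComplex.d (-((0:ℕ):ℤ)) 1 = 0 := by
      exact (CochainComplex.isZero_of_isStrictlyLE _ 0 _ (by lia)).eq_of_tgt _ _
    rw [h0, zero_comp] at hl
    rw [← cancel_epi (P.cochainComplexXIso (-((0:ℕ):ℤ)) 0 rfl).hom, ← hl, comp_zero]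

end Bridge

end LCSurj

namespace LCSurj

open CategoryTheory.Abelian

variable {R : Type u} [CommRing R]

/-- The projection `R/J → R/I` for `J ≤ I`. -/
noncomputable abbrev qmap {J I : Ideal R} (h : J ≤ I) :
    ModuleCat.of R (R ⧸ J) ⟶ ModuleCat.of R (R ⧸ I) :=
  ModuleCat.ofHom (Submodule.mapQ J I LinearMap.id h)

lemma qmap_comp {K J I : Ideal R} (h : K ≤ J) (h' : J ≤ I) :
    qmap h ≫ qmap h' = qmap (h.trans h') := by
  ext
  rfl

/-- Restriction of Ext classes along `R/J → R/I`. -/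
noncomputable def res {J I : Ideal R} (h : J ≤ I) {M : ModuleCat.{u} R} {i : ℕ}
    (ξ : Abelian.Ext (ModuleCat.of R (R ⧸ I)) M i) : Abelian.Ext (ModuleCat.of R (R ⧸ J)) M i :=
  (Ext.mk₀ (qmap h)).comp ξ (zero_add i)

section
variable {M N : ModuleCat.{u} R} {i : ℕ}

lemma res_res {K J I : Ideal R} (h : K ≤ J) (h' : J ≤ I)
    (ξ : Abelian.Ext (ModuleCat.of R (R ⧸ I)) M i) : res h (res h' ξ) = res (h.trans h') ξ := by
  unfold res
  rw [Ext.mk₀_comp_mk₀_assoc, qmap_comp]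

lemma res_zero {J I : Ideal R} (h : J ≤ I) :
    res h (0 : Abelian.Ext (ModuleCat.of R (R ⧸ I)) M i) = 0 := by
  simp [res]

lemma res_smul {J I : Ideal R} (h : J ≤ I) (r : R)
    (ξ : Abelian.Ext (ModuleCat.of R (R ⧸ I)) M i) : res h (r • ξ) = r • res h ξ := by
  simp [res]

lemma res_comp {J I : Ideal R} (h : J ≤ I) {j k : ℕ} (hk : i + j = k)
    (ξ : Abelian.Ext (ModuleCat.of R (R ⧸ I)) M i) (β : Abelian.Ext M N j) :
    res h (ξ.comp β hk) = (res h ξ).comp β hk := by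
  unfold res
  rw [Ext.comp_assoc _ _ _ (zero_add i) hk (by lia)]

/-- Multiplication by `r` as an endomorphism acts on `Ext` as the scalar. -/
lemma smul_eq_pre (X : ModuleCat.{u} R) (r : R) (ξ : Abelian.Ext X M i) :
    (Ext.mk₀ (r • 𝟙 X)).comp ξ (zero_add i) = r • ξ := by
  rw [Ext.mk₀_smul, Ext.smul_comp, Ext.mk₀_id_comp]

lemma smul_eq_post (r : R) {X : ModuleCat.{u} R} (ξ : Abelian.Ext X M i) :
    ξ.comp (Ext.mk₀ (r • 𝟙 M)) (add_zero i) = r • ξ := by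
  rw [Ext.mk₀_smul, Ext.comp_smul, Ext.comp_mk₀_id]

lemma smul_zero_of_mem {I : Ideal R} {y : R} (hy : y ∈ I)
    (ξ : Abelian.Ext (ModuleCat.of R (R ⧸ I)) M i) : y • ξ = 0 := by
  rw [← smul_eq_pre]
  have : y • 𝟙 (ModuleCat.of R (R ⧸ I)) = 0 := by
    ext
    change y • (Ideal.Quotient.mk I 1) = 0
    have : Ideal.Quotient.mk I (y * 1) = 0 := by
      rw [mul_one]
      exact Ideal.Quotient.eq_zero_iff_mem.2 hy
    exact this
  rw [this, Ext.mk₀_zero, Ext.zero_comp]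

lemma smul_zero_of_annih {X : ModuleCat.{u} R} {y : R} (hy : ∀ m : M, y • m = 0)
    (ξ : Abelian.Ext X M i) : y • ξ = 0 := by
  rw [← smul_eq_post]
  have : y • 𝟙 M = 0 := by
    ext m
    exact hy m
  rw [this, Ext.mk₀_zero, Ext.comp_zero]

end

/-- Elements of `Ext^i(R/I, M)` become killed by a power of `x` after restriction. -/
def Tors (x : R) (M : ModuleCat.{u} R) (i : ℕ) : Prop :=
  ∀ (I : Ideal R) (ξ : Abelian.Ext (ModuleCat.of R (R ⧸ I)) M i),
    ∃ (J : Ideal R) (h : J ≤ I), I ≤ J.radical ∧ ∃ k : ℕ, x ^ k • res h ξ = 0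

lemma Tors.ses {x : R} {i : ℕ} {S : ShortComplex (ModuleCat.{u} R)} (hS : S.ShortExact)
    (h1 : Tors x S.X₁ i) (h3 : Tors x S.X₃ i) : Tors x S.X₂ i := by
  intro I ξ
  obtain ⟨J, hJ, hJr, k, hk⟩ := h3 I (ξ.comp (Ext.mk₀ S.g) (add_zero i))
  rw [res_comp, ← Ext.smul_comp] at hk
  obtain ⟨ζ, hζ⟩ := Ext.covariant_sequence_exact₂ _ hS _ hk
  obtain ⟨K, hK, hKr, l, hl⟩ := h1 J ζ
  refine ⟨K, hK.trans hJ, hJr.trans (Ideal.radical_le_radical_iff.2 hKr), l + k, ?_⟩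
  rw [← res_res hK hJ, pow_add, mul_smul, ← res_smul, ← hζ, res_comp, ← Ext.smul_comp, hl,
    Ext.zero_comp]

lemma Tors.of_annih {x : R} {i : ℕ} {M : ModuleCat.{u} R} (hx : ∀ m : M, x • m = 0) :
    Tors x M i := by
  intro I ξ
  exact ⟨I, le_rfl, Ideal.le_radical, 1, smul_zero_of_annih (by rw [pow_one]; exact hx) _⟩

/-- Every element is killed by a power of `I`. -/
def IsTor (I : Ideal R) (N : Type u) [AddCommGroup N] [Module R N] : Prop :=
  ∀ n : N, ∃ t : ℕ, ∀ r ∈ I ^ t, r • n = 0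

/-- The `I`-torsion submodule. -/
def gam (I : Ideal R) (E : Type u) [AddCommGroup E] [Module R E] : Submodule R E where
  carrier := {e | ∃ t : ℕ, ∀ r ∈ I ^ t, r • e = 0}
  zero_mem' := ⟨0, by simp⟩
  add_mem' := by
    rintro a b ⟨s, hs⟩ ⟨t, ht⟩
    refine ⟨s + t, fun r hr => ?_⟩
    rw [smul_add, hs r (Ideal.pow_le_pow_right (by lia) hr),
      ht r (Ideal.pow_le_pow_right (by lia) hr), add_zero]
  smul_mem' := by
    rintro c e ⟨t, ht⟩
    exact ⟨t, fun r hr => by rw [smul_comm, ht r hr, smul_zero]⟩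

lemma isTor_gam (I : Ideal R) (E : Type u) [AddCommGroup E] [Module R E] : IsTor I (gam I E) := by
  rintro ⟨e, t, ht⟩
  exact ⟨t, fun r hr => Subtype.ext (ht r hr)⟩

/-- A finite module which is torsion is killed by a power. -/
lemma IsTor.bound {I : Ideal R} {N : Type u} [AddCommGroup N] [Module R N] (h : IsTor I N)
    {B : Type u} [AddCommGroup B] [Module R B] [Module.Finite R B] (f : B →ₗ[R] N) :
    ∃ t : ℕ, ∀ r ∈ I ^ t, ∀ b : B, r • f b = 0 := by
  obtain ⟨s, hs⟩ := (Module.Finite.fg_top : (⊤ : Submodule R B).FG)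
  choose t ht using h
  refine ⟨∑ b ∈ s, t (f b), fun r hr b => ?_⟩
  have hb : b ∈ Submodule.span R (s : Set B) := by rw [hs]; trivial
  induction hb using Submodule.span_induction with
  | mem b hb =>
    exact ht (f b) r (Ideal.pow_le_pow_right (Finset.single_le_sum (f := fun b => t (f b))
      (fun _ _ => Nat.zero_le _) hb) hr)
  | zero => simp
  | add a b _ _ ha hb => rw [map_add, smul_add, ha, hb, add_zero]
  | smul c b _ hb => rw [map_smul, smul_comm, hb, smul_zero]

lemma gam_injective [IsNoetherianRing R] (I : Ideal R) (E : Type u) [AddCommGroup E] [Module R E]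
    [Module.Injective R E] : Module.Injective R (gam I E) := by
  apply Module.Baer.injective
  intro b f
  obtain ⟨s, hs⟩ := (isTor_gam I E).bound f
  obtain ⟨k, hk⟩ := I.exists_pow_inf_eq_pow_smul (M := R) b
  -- `I ^ (s + k) ⊓ b ≤ I ^ s * b`
  have hAR : I ^ (s + k) ⊓ b ≤ I ^ s * b := by
    have := hk (s + k) (by lia)
    simp only [smul_eq_mul, Ideal.mul_top, Nat.add_sub_cancel] at this
    rw [this]
    exact Ideal.mul_mono_right inf_le_right
  have hker : ∀ y (hy : y ∈ b), y ∈ I ^ (s + k) → f ⟨y, hy⟩ = 0 := by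
    intro y hy hy'
    have h1 : y ∈ I ^ s * b := hAR ⟨hy', hy⟩
    have h2 : ∀ z ∈ I ^ s * b, ∃ hz : z ∈ b, f ⟨z, hz⟩ = 0 := by
      intro z hz
      induction hz using Submodule.mul_induction_on' with
      | mem_mul_mem r hr c hc =>
        exact ⟨b.mul_mem_left _ hc, by
          have := hs r hr ⟨c, hc⟩
          rw [← map_smul] at this
          exact this⟩
      | add z _ w _ hz hw =>
        obtain ⟨hz, hz'⟩ := hz
        obtain ⟨hw, hw'⟩ := hw
        refine ⟨b.add_mem hz hw, ?_⟩
        have := map_add f ⟨z, hz⟩ ⟨w, hw⟩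
        rw [hz', hw', add_zero] at this
        exact this
    exact (h2 y h1).2
  -- the map on `b / (b ∩ I^t)`
  let J := I ^ (s + k)
  let π : b →ₗ[R] R ⧸ J := J.mkQ.comp b.subtype
  let g : (b ⧸ LinearMap.ker π) →ₗ[R] E := (LinearMap.ker π).liftQ ((gam I E).subtype.comp f) (by
    rintro ⟨y, hy⟩ hyk
    have : y ∈ J := Ideal.Quotient.eq_zero_iff_mem.1 hyk
    simp [hker y hy this])
  let j : (b ⧸ LinearMap.ker π) →ₗ[R] R ⧸ J := (LinearMap.ker π).liftQ π le_rfl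
  have hj : Function.Injective j := by
    rw [← LinearMap.ker_eq_bot]
    exact Submodule.ker_liftQ_eq_bot _ _ _ le_rfl
  obtain ⟨e, he⟩ := Module.Injective.out j hj g
  have hmem : ∀ q, e q ∈ gam I E := by
    intro q
    refine ⟨s + k, fun r hr => ?_⟩
    obtain ⟨q, rfl⟩ := Submodule.Quotient.mk_surjective _ q
    rw [← map_smul, ← Submodule.Quotient.mk_smul]
    have : (Submodule.Quotient.mk (r • q) : R ⧸ J) = 0 := by
      rw [Submodule.Quotient.mk_eq_zero]
      exact J.mul_mem_right _ hr
    rw [this, map_zero]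
  refine ⟨(e.codRestrict _ hmem).comp J.mkQ, fun y hy => ?_⟩
  apply Subtype.ext
  have := he (Submodule.Quotient.mk ⟨y, hy⟩)
  exact this

lemma exists_torsion_injective [IsNoetherianRing R] (I : Ideal R) (N : ModuleCat.{u} R)
    (hN : IsTor I N) :
    ∃ (S : ShortComplex (ModuleCat.{u} R)) (_ : S.ShortExact), S.X₁ = N ∧
      Injective S.X₂ ∧ IsTor I S.X₂ ∧ IsTor I S.X₃ := by
  let E := Injective.under N
  have hE : Module.Injective R E := 
    (Module.injective_iff_injective_object R E).2 (inferInstanceAs (Injective (Injective.under N)))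
  have hG := gam_injective I E
  let ι := (Injective.ι N).hom
  have hι : Function.Injective ι := (ModuleCat.mono_iff_injective _).1 inferInstance
  have hmem : ∀ n, ι n ∈ gam I E := by
    intro n
    obtain ⟨t, ht⟩ := hN n
    exact ⟨t, fun r hr => by rw [← map_smul, ht r hr, map_zero]⟩
  let j : N →ₗ[R] gam I E := ι.codRestrict _ hmem
  have hj : Function.Injective j := fun a b h => hι (congrArg Subtype.val h)
  let S : ShortComplex (ModuleCat.{u} R) := ShortComplex.mk (ModuleCat.ofHom j)
    (ModuleCat.ofHom (LinearMap.range j).mkQ) (by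
      ext n
      simp)
  have hS : S.ShortExact := by
    refine { exact := ?_, mono_f := (ModuleCat.mono_iff_injective _).2 hj,
             epi_g := (ModuleCat.epi_iff_surjective _).2 (Submodule.mkQ_surjective _) }
    rw [ShortComplex.ShortExact.moduleCat_exact_iff_function_exact]
    exact LinearMap.exact_map_mkQ_range j
  refine ⟨S, hS, rfl, ?_, isTor_gam I E, ?_⟩
  · exact Module.injective_object_of_injective_module R (gam I E)
  · intro q
    obtain ⟨e, rfl⟩ := Submodule.mkQ_surjective _ q
    obtain ⟨t, ht⟩ := isTor_gam I E e
    exact ⟨t, fun r hr => by rw [← map_smul, ht r hr, map_zero]⟩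

lemma vanish_of_isTor [IsNoetherianRing R] (I : Ideal R) (i : ℕ) :
    ∀ (N : ModuleCat.{u} R) (_ : IsTor I N)
      (ξ : Abelian.Ext (ModuleCat.of R (R ⧸ I)) N (i + 1)),
      ∃ (J : Ideal R) (h : J ≤ I), I ≤ J.radical ∧ res h ξ = 0 := by
  induction i with
  | zero =>
    intro N hN ξ
    obtain ⟨S, hS, rfl, hinj, h2, h3⟩ := exists_torsion_injective I N hN
    obtain ⟨ζ, rfl⟩ := Ext.covariant_sequence_exact₁ _ hS ξ (Ext.eq_zero_of_injective _) (zero_add 1)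
    obtain ⟨f, rfl⟩ := (Ext.mk₀_bijective _ _).2 ζ
    obtain ⟨e, he⟩ := (ModuleCat.epi_iff_surjective _).1 hS.epi_g
      (f.hom (Ideal.Quotient.mk I 1))
    obtain ⟨t, ht⟩ := h2 e
    let J := I ^ (t + 1)
    have hJ : J ≤ I := Ideal.pow_le_self (by lia)
    let g : ModuleCat.of R (R ⧸ J) ⟶ S.X₂ :=
      ModuleCat.ofHom (J.liftQ (LinearMap.toSpanSingleton R S.X₂ e) (by
        intro r hr
        exact ht r (Ideal.pow_le_pow_right (by lia) hr)))
    refine ⟨J, hJ, (Ideal.radical_pow I (Nat.succ_ne_zero t)).symm ▸ Ideal.le_radical, ?_⟩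
    have hg : qmap hJ ≫ f = g ≫ S.g := by
      ext
      change f.hom (Ideal.Quotient.mk I 1) = S.g.hom ((1 : R) • e)
      rw [one_smul]
      exact he.symm
    rw [res_comp]
    unfold res
    rw [Ext.mk₀_comp_mk₀, hg, ← Ext.mk₀_comp_mk₀, Ext.comp_assoc _ _ _ (zero_add 0) (zero_add 1) (by lia),
      hS.comp_extClass, Ext.comp_zero]
  | succ i ih =>
    intro N hN ξ
    obtain ⟨S, hS, rfl, hinj, h2, h3⟩ := exists_torsion_injective I N hN
    obtain ⟨ζ, rfl⟩ := Ext.covariant_sequence_exact₁ _ hS ξ (Ext.eq_zero_of_injective _) rfl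
    obtain ⟨J, hJ, hJr, h⟩ := ih _ h3 ζ
    exact ⟨J, hJ, hJr, by rw [res_comp, h, Ext.zero_comp]⟩

end LCSurj

namespace LCSurj

open CategoryTheory.Abelian

variable {R : Type u} [CommRing R]

/-- Chains of primes in the support of `M` avoiding `x` have length `< n`. -/
def DimLt (x : R) (M : Type u) [AddCommGroup M] [Module R M] (n : ℕ) : Prop :=
  ∀ l : LTSeries (PrimeSpectrum R),
    (∀ q ∈ l, q ∈ Module.support R M ∧ x ∉ q.asIdeal) → l.length < n

lemma DimLt.mono {x : R} {M N : Type u} [AddCommGroup M] [Module R M] [AddCommGroup N] [Module R N]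
    {n : ℕ} (h : DimLt x M n) (hs : Module.support R N ⊆ Module.support R M) : DimLt x N n :=
  fun l hl => h l fun q hq => ⟨hs (hl q hq).1, (hl q hq).2⟩

/-- The key torsion statement for a module of the form `R/p`. -/
lemma tors_prime [IsNoetherianRing R] (x : R) (n : ℕ)
    (IH : ∀ (M : Type u) [AddCommGroup M] [Module R M] [Module.Finite R M],
      DimLt x M n → ∀ i ≥ n, Tors x (ModuleCat.of R M) i)
    (N : Type u) [AddCommGroup N] [Module R N] [Module.Finite R N] (p : PrimeSpectrum R)
    (e : N ≃ₗ[R] R ⧸ p.1) (hx : x ∉ p.asIdeal)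
    (hN : DimLt x N (n + 1)) (i : ℕ) (hi : n ≤ i) : Tors x (ModuleCat.of R N) (i + 1) := by
  have hann : ∀ r ∈ p.asIdeal, ∀ m : N, r • m = 0 := by
    intro r hr m
    apply e.injective
    rw [map_smul, map_zero]
    obtain ⟨s, hs⟩ := Ideal.Quotient.mk_surjective (e m)
    rw [← hs]
    have : Ideal.Quotient.mk p.asIdeal (r * s) = 0 :=
      Ideal.Quotient.eq_zero_iff_mem.2 (p.asIdeal.mul_mem_right _ hr)
    exact this
  have hreg : ∀ r ∉ p.asIdeal, ∀ m : N, r • m = 0 → m = 0 := by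
    intro r hr m hm
    apply e.injective
    rw [map_zero]
    have h0 : r • e m = 0 := by rw [← map_smul, hm, map_zero]
    obtain ⟨s, hs⟩ := Ideal.Quotient.mk_surjective (e m)
    rw [← hs] at h0 ⊢
    have h1 : Ideal.Quotient.mk p.asIdeal (r * s) = 0 := h0
    rw [Ideal.Quotient.eq_zero_iff_mem] at h1 ⊢
    exact (p.2.mem_or_mem h1).resolve_left hr
  have hsupp : p ∈ Module.support R N := by
    rw [Module.mem_support_iff_exists_annihilator]
    refine ⟨e.symm 1, fun r hr => ?_⟩
    by_contra h
    have := hreg r h _ ((Submodule.mem_annihilator_span_singleton _ _).1 hr)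
    have h2 : (1 : R ⧸ p.asIdeal) = 0 := by
      have := congrArg e this
      simp only [LinearEquiv.apply_symm_apply, map_zero] at this
      exact this
    exact p.2.ne_top ((Ideal.eq_top_iff_one _).2 (Ideal.Quotient.eq_zero_iff_mem.1 h2))
  intro I ξ
  by_cases hI : I ≤ p.asIdeal
  · obtain ⟨J, hJ, hJr, h⟩ := vanish_of_isTor I i (ModuleCat.of R N)
      (fun m => ⟨1, fun r hr => hann r (hI (by simpa using hr)) m⟩) ξ
    exact ⟨J, hJ, hJr, 0, by rw [h, smul_zero]⟩
  · obtain ⟨y, hyI, hyp⟩ := Set.not_subset.1 hI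
    let μ : N →ₗ[R] N := LinearMap.lsmul R N y
    let S : ShortComplex (ModuleCat.{u} R) := ShortComplex.mk (ModuleCat.ofHom μ)
      (ModuleCat.ofHom (LinearMap.range μ).mkQ) (by
        ext m
        simp)
    have hS : S.ShortExact := by
      refine { exact := ?_, mono_f := (ModuleCat.mono_iff_injective _).2 ?_,
               epi_g := (ModuleCat.epi_iff_surjective _).2 (Submodule.mkQ_surjective _) }
      · rw [ShortComplex.ShortExact.moduleCat_exact_iff_function_exact]
        exact LinearMap.exact_map_mkQ_range μ
      · exact (injective_iff_map_eq_zero μ).2 fun m hm => hreg y hyp m hm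
    have hξ : ξ.comp (Ext.mk₀ S.f) (add_zero _) = 0 := by
      have : S.f = y • 𝟙 (ModuleCat.of R N) := by
        ext m
        rfl
      rw [this]
      exact (smul_eq_post y ξ).trans (smul_zero_of_mem hyI ξ)
    obtain ⟨ζ, rfl⟩ := Ext.covariant_sequence_exact₁ _ hS ξ hξ rfl
    have hdim : DimLt x (N ⧸ LinearMap.range μ) n := by
      intro l hl
      have hmem : ∀ q ∈ l, q ∈ Module.support R N ∧ x ∉ q.asIdeal := fun q hq =>
        ⟨Module.support_subset_of_surjective _ (Submodule.mkQ_surjective _) (hl q hq).1,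
          (hl q hq).2⟩
      have hhead := hl l.head l.head_mem
      have hlt : p < l.head := by
        refine lt_of_le_of_ne ?_ ?_
        · intro r hr
          exact Module.annihilator_le_of_mem_support (hmem _ l.head_mem).1
            (Module.mem_annihilator.2 (hann r hr))
        · intro h
          apply hyp
          rw [h]
          refine Module.annihilator_le_of_mem_support hhead.1 (Module.mem_annihilator.2 ?_)
          intro m
          obtain ⟨m, rfl⟩ := Submodule.mkQ_surjective _ m
          rw [← map_smul]
          exact (Submodule.Quotient.mk_eq_zero _).2 ⟨m, rfl⟩
      have := hN (l.cons p hlt) (by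
        intro q hq
        have hq' : q = p ∨ q ∈ l := by
          rw [← RelSeries.mem_toList, RelSeries.toList_cons, List.mem_cons,
            RelSeries.mem_toList] at hq
          exact hq
        rcases hq' with h | h
        · subst h
          exact ⟨hsupp, hx⟩
        · exact hmem q h)
      simpa using this
    obtain ⟨J, hJ, hJr, k, hk⟩ := IH _ hdim i hi I ζ
    refine ⟨J, hJ, hJr, k, ?_⟩
    rw [res_comp, ← Ext.smul_comp, hk, Ext.zero_comp]

theorem tors_of_dimLt [IsNoetherianRing R] (x : R) (n : ℕ) :
    ∀ (M : Type u) [AddCommGroup M] [Module R M] [Module.Finite R M],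
      DimLt x M n → ∀ i ≥ n, Tors x (ModuleCat.of R M) i := by
  induction n with
  | zero =>
    intro M _ _ hM
    induction hM using IsNoetherianRing.induction_on_isQuotientEquivQuotientPrime R with
    | subsingleton N => exact fun _ i _ => Tors.of_annih (fun m => Subsingleton.elim (α := N) _ _)
    | quotient N p e =>
      intro h i _
      by_cases hx : x ∈ p.asIdeal
      · refine Tors.of_annih (fun (m : N) => ?_)
        apply e.injective
        rw [map_smul, map_zero]
        obtain ⟨s, hs⟩ := Ideal.Quotient.mk_surjective (e m)
        rw [← hs]
        have : Ideal.Quotient.mk p.asIdeal (x * s) = 0 :=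
          Ideal.Quotient.eq_zero_iff_mem.2 (p.asIdeal.mul_mem_right _ hx)
        exact this
      · exfalso
        have hp : p ∈ Module.support R N := by
          rw [e.support_eq, Module.support_eq_zeroLocus, Ideal.annihilator_quotient]
          exact fun r hr => hr
        have := h (RelSeries.singleton _ p) (by
          intro q hq
          have : q = p := by
            obtain ⟨y, hy⟩ := hq
            exact hy.symm
          subst this
          exact ⟨hp, hx⟩)
        simp at this
    | exact N₁ N₂ N₃ f g hf hg hfg h1 h3 =>
      intro h i hi
      let S : ShortComplex (ModuleCat.{u} R) := ShortComplex.mk (ModuleCat.ofHom f)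
        (ModuleCat.ofHom g) (by
          ext m
          exact hfg.apply_apply_eq_zero m)
      have hS : S.ShortExact := ModuleCat.shortComplex_shortExact S hfg hf hg
      exact Tors.ses hS
        (h1 (h.mono (Module.support_subset_of_injective f hf)) i hi)
        (h3 (h.mono (Module.support_subset_of_surjective g hg)) i hi)
  | succ n IH =>
    intro M _ _ hM
    induction hM using IsNoetherianRing.induction_on_isQuotientEquivQuotientPrime R with
    | subsingleton N => exact fun _ i _ => Tors.of_annih (fun m => Subsingleton.elim (α := N) _ _)
    | quotient N p e =>
      intro h i hi
      by_cases hx : x ∈ p.asIdeal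
      · refine Tors.of_annih (fun (m : N) => ?_)
        apply e.injective
        rw [map_smul, map_zero]
        obtain ⟨s, hs⟩ := Ideal.Quotient.mk_surjective (e m)
        rw [← hs]
        have : Ideal.Quotient.mk p.asIdeal (x * s) = 0 :=
          Ideal.Quotient.eq_zero_iff_mem.2 (p.asIdeal.mul_mem_right _ hx)
        exact this
      · obtain ⟨i, rfl⟩ : ∃ j, i = j + 1 := ⟨i - 1, by lia⟩
        exact tors_prime x n IH N p e hx h i (by lia)
    | exact N₁ N₂ N₃ f g hf hg hfg h1 h3 =>
      intro h i hi
      let S : ShortComplex (ModuleCat.{u} R) := ShortComplex.mk (ModuleCat.ofHom f)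
        (ModuleCat.ofHom g) (by
          ext m
          exact hfg.apply_apply_eq_zero m)
      have hS : S.ShortExact := ModuleCat.shortComplex_shortExact S hfg hf hg
      exact Tors.ses hS
        (h1 (h.mono (Module.support_subset_of_injective f hf)) i hi)
        (h3 (h.mono (Module.support_subset_of_surjective g hg)) i hi)

end LCSurj

namespace LCSurj

open CategoryTheory.Abelian

variable {R : Type u} [CommRing R]

lemma exists_stab [IsNoetherianRing R] (x : R) :
    ∃ c : ℕ, ∀ (j : ℕ) (r : R), x ^ j * r = 0 → x ^ c * r = 0 := by
  let F : ℕ →o Ideal R :=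
    { toFun := fun j => LinearMap.ker (LinearMap.mulLeft R (x ^ j))
      monotone' := by
        intro i j hij r hr
        obtain ⟨k, rfl⟩ := Nat.exists_eq_add_of_le hij
        have : x ^ i * r = 0 := hr
        change x ^ (i + k) * r = 0
        rw [pow_add, mul_right_comm, this, zero_mul] }
  obtain ⟨c, hc⟩ := monotone_stabilizes_iff_noetherian.2 ‹IsNoetherianRing R› F
  refine ⟨c, fun j r hr => ?_⟩
  rcases le_total c j with h | h
  · have : r ∈ F j := hr
    rw [← hc j h] at this
    exact this
  · exact F.monotone h hr

lemma exists_AR [IsNoetherianRing R] (I : Ideal R) (z : R) :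
    ∃ t : ℕ, ∀ r : R, z * r ∈ I ^ (t + 1) → ∃ b ∈ I, z * r = z * b := by
  obtain ⟨k, hk⟩ := I.exists_pow_inf_eq_pow_smul (M := R) (Ideal.span {z})
  refine ⟨k, fun r hr => ?_⟩
  have h := hk (k + 1) (by lia)
  simp only [smul_eq_mul, Ideal.mul_top, Nat.add_sub_cancel_left, pow_one] at h
  have h1 : z * r ∈ I * (I ^ k ⊓ Ideal.span {z}) := by
    rw [← h]
    exact ⟨hr, Ideal.mul_mem_right _ _ (Ideal.mem_span_singleton_self z)⟩
  have h2 : z * r ∈ I * Ideal.span {z} := Ideal.mul_mono_right inf_le_right h1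
  obtain ⟨b, hb, hb'⟩ := Ideal.mem_mul_span_singleton.1 h2
  exact ⟨b, hb, by rw [← hb', mul_comm]⟩

/-- A class killed by a power of `x` extends, after restriction, to one over an ideal
containing a power of `x`. -/
lemma extend_class [IsNoetherianRing R] {M : ModuleCat.{u} R} {i : ℕ} {I : Ideal R}
    (ξ : Abelian.Ext (ModuleCat.of R (R ⧸ I)) M i) (x : R) (k : ℕ) (hk : x ^ k • ξ = 0) :
    ∃ (J : Ideal R) (h : J ≤ I), I ≤ J.radical ∧ ∃ (J' : Ideal R) (h' : J ≤ J'),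
      x ∈ J'.radical ∧ ∃ η : Abelian.Ext (ModuleCat.of R (R ⧸ J')) M i,
        res h' η = res h ξ := by
  obtain ⟨c, hc⟩ := exists_stab x
  let z := x ^ (k + c)
  obtain ⟨t, ht⟩ := exists_AR I z
  let J := I ^ (t + 1)
  have hJ : J ≤ I := Ideal.pow_le_self (by lia)
  have key : ∀ r, z * r ∈ J → x ^ c * r ∈ I := by
    intro r hr
    obtain ⟨b, hb, h⟩ := ht r hr
    have h1 : x ^ c * (r - b) = 0 := hc (k + c) _ (by rw [mul_sub]; exact sub_eq_zero.2 h)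
    rw [mul_sub, sub_eq_zero] at h1
    rw [h1]
    exact I.mul_mem_left _ hb
  let μ : R →ₗ[R] R ⧸ J := J.mkQ.comp (LinearMap.mulLeft R z)
  let C : Ideal R := LinearMap.ker μ
  have hμ : ∀ r ∈ C, z * r ∈ J := fun r hr => Ideal.Quotient.eq_zero_iff_mem.1 hr
  let f : (R ⧸ C) →ₗ[R] R ⧸ J := C.liftQ μ le_rfl
  let g : (R ⧸ C) →ₗ[R] R ⧸ I := C.liftQ (I.mkQ.comp (LinearMap.mulLeft R (x ^ c))) (by
    intro r hr
    exact Ideal.Quotient.eq_zero_iff_mem.2 (key r (hμ r hr)))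
  have hf : Function.Injective f := by
    rw [← LinearMap.ker_eq_bot]
    exact Submodule.ker_liftQ_eq_bot _ _ _ le_rfl
  let J' := J ⊔ Ideal.span {z}
  have hJ' : J ≤ J' := le_sup_left
  have hfg : ModuleCat.ofHom f ≫ qmap hJ = x ^ k • ModuleCat.ofHom g := by
    ext
    change Ideal.Quotient.mk I (z * 1) = Ideal.Quotient.mk I (x ^ k * (x ^ c * 1))
    simp only [z, pow_add, mul_one]
  have h0 : ModuleCat.ofHom f ≫ qmap hJ' = 0 := by
    ext
    change Ideal.Quotient.mk J' (z * 1) = 0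
    rw [mul_one, Ideal.Quotient.eq_zero_iff_mem]
    exact le_sup_right (a := J) (Ideal.mem_span_singleton_self z)
  let S : ShortComplex (ModuleCat.{u} R) := ShortComplex.mk (ModuleCat.ofHom f) (qmap hJ') h0
  have hS : S.ShortExact := by
    refine ModuleCat.shortComplex_shortExact S ?_ hf ?_
    · intro q
      constructor
      · intro hq
        obtain ⟨r, rfl⟩ := Submodule.Quotient.mk_surjective _ q
        have hr : r ∈ J' := Ideal.Quotient.eq_zero_iff_mem.1 hq
        obtain ⟨a, ha, b, hb, rfl⟩ := Submodule.mem_sup.1 hr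
        obtain ⟨s, rfl⟩ := Ideal.mem_span_singleton.1 hb
        refine ⟨Submodule.Quotient.mk s, ?_⟩
        change Ideal.Quotient.mk J (z * s) = Ideal.Quotient.mk J (a + z * s)
        rw [map_add, Ideal.Quotient.eq_zero_iff_mem.2 ha, zero_add]
      · rintro ⟨s, rfl⟩
        exact LinearMap.congr_fun (congrArg ModuleCat.Hom.hom h0) s
    · intro q
      obtain ⟨r, rfl⟩ := Submodule.Quotient.mk_surjective _ q
      exact ⟨Submodule.Quotient.mk r, rfl⟩
  obtain ⟨η, hη⟩ := Ext.contravariant_sequence_exact₂ hS M (res hJ ξ) (by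
    change (Ext.mk₀ (ModuleCat.ofHom f)).comp ((Ext.mk₀ (qmap hJ)).comp ξ (zero_add i))
      (zero_add i) = 0
    rw [Ext.mk₀_comp_mk₀_assoc, hfg, Ext.mk₀_smul, Ext.smul_comp, ← Ext.comp_smul, hk,
      Ext.comp_zero])
  refine ⟨J, hJ, (Ideal.radical_pow I (Nat.succ_ne_zero t)).symm ▸ Ideal.le_radical, J', hJ',
    ⟨k + c, le_sup_right (a := J) (Ideal.mem_span_singleton_self z)⟩, η, hη⟩

lemma extend_finset [IsNoetherianRing R] {M : ModuleCat.{u} R} {i : ℕ} {I : Ideal R}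
    (ξ : Abelian.Ext (ModuleCat.of R (R ⧸ I)) M i) (s : Finset R) :
    (∀ x ∈ s, Tors x M i) →
    ∃ (I' : Ideal R) (h : I' ≤ I), I ≤ I'.radical ∧ ∃ (J : Ideal R) (h' : I' ≤ J),
      (∀ x ∈ s, x ∈ J.radical) ∧ I ≤ J.radical ∧
        ∃ η : Abelian.Ext (ModuleCat.of R (R ⧸ J)) M i, res h' η = res h ξ := by
  classical
  induction s using Finset.induction_on with
  | empty =>
    intro _
    exact ⟨I, le_rfl, Ideal.le_radical, I, le_rfl, by simp, Ideal.le_radical, ξ, rfl⟩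
  | insert x s _ ih =>
    intro hs
    obtain ⟨I', hI', hr, J, hJ, hsJ, hIJ, η, hη⟩ := ih fun y hy => hs y (Finset.mem_insert_of_mem hy)
    obtain ⟨J1, h1, hr1, k, hk⟩ := hs x (Finset.mem_insert_self x s) J η
    obtain ⟨J2, h2, hr2, J3, h3, hx3, η3, hη3⟩ := extend_class (res h1 η) x k hk
    have hJ2 : J.radical ≤ J2.radical := Ideal.radical_le_radical_iff.2
      (hr1.trans (Ideal.radical_le_radical_iff.2 hr2))
    have hJ3 : J.radical ≤ J3.radical := hJ2.trans (Ideal.radical_mono h3)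
    refine ⟨I' ⊓ J2, inf_le_left.trans hI', ?_, J3, inf_le_right.trans h3, ?_, hIJ.trans hJ3,
      η3, ?_⟩
    · rw [Ideal.radical_inf]
      exact le_inf hr (hIJ.trans hJ2)
    · intro y hy
      rcases Finset.mem_insert.1 hy with rfl | hy
      · exact hx3
      · exact hJ3 (hsJ y hy)
    · rw [← res_res inf_le_right h3, hη3, res_res, res_res, ← res_res inf_le_left hI', ← hη, res_res]

lemma dimLt_of_moduleDim [IsLocalRing R] (M : Type u) [AddCommGroup M] [Module R M]
    (d : ℕ) (hd : moduleDim R M = (d : ℕ∞)) (x : R) (hx : x ∈ IsLocalRing.maximalIdeal R) :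
    DimLt x M d := by
  intro l hl
  let mm : PrimeSpectrum R := ⟨IsLocalRing.maximalIdeal R, inferInstance⟩
  have hlt : l.last < mm := by
    refine lt_of_le_of_ne (IsLocalRing.le_maximalIdeal l.last.2.ne_top) ?_
    intro h
    apply (hl l.last l.last_mem).2
    rw [h]
    exact hx
  let l' : LTSeries (PrimeSpectrum R) := l.snoc mm hlt
  have hl' : ∀ j, l.head ≤ l' j := by
    intro j
    have := LTSeries.head_le l' j
    simpa [l'] using this
  let Z := PrimeSpectrum.zeroLocus (R := R) (l.head.asIdeal : Set R)
  let l'' : LTSeries Z :=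
    { length := l'.length
      toFun := fun j => ⟨l' j, hl' j⟩
      step := fun j => l'.step j }
  have h1 : (l''.length : WithBot ℕ∞) ≤ ringKrullDim (R ⧸ l.head.asIdeal) := by
    rw [ringKrullDim_quotient]
    exact Order.LTSeries.length_le_krullDim l''
  have h2 : ringKrullDim (R ⧸ l.head.asIdeal) ≤ moduleDim R M :=
    le_iSup₂_of_le l.head (hl _ l.head_mem).1 le_rfl
  rw [hd] at h2
  have h3 : ((l.length + 1 : ℕ) : WithBot ℕ∞) ≤ (d : ℕ) := h1.trans h2
  have h4 : l.length + 1 ≤ d := by exact_mod_cast h3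
  exact h4

/-- The key statement about new-style `Ext`. -/
theorem key_ext [IsNoetherianRing R] [IsLocalRing R] (M : Type u) [AddCommGroup M] [Module R M]
    [Module.Finite R M] (d : ℕ) (hd : moduleDim R M = (d : ℕ∞)) (a : Ideal R)
    (ha : a ≤ IsLocalRing.maximalIdeal R) (t : ℕ)
    (ξ : Abelian.Ext (ModuleCat.of R (R ⧸ a ^ t)) (ModuleCat.of R M) d) :
    ∃ (s k : ℕ) (h : a ^ s ≤ a ^ t) (_ : k ≤ s) (_ : t ≤ s)
      (h' : a ^ s ≤ IsLocalRing.maximalIdeal R ^ k)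
      (η : Abelian.Ext (ModuleCat.of R (R ⧸ IsLocalRing.maximalIdeal R ^ k)) (ModuleCat.of R M) d),
      res h' η = res h ξ := by
  obtain ⟨S, hS⟩ := (isNoetherianRing_iff_ideal_fg R).1 inferInstance (IsLocalRing.maximalIdeal R)
  obtain ⟨I', hI', hr, J, hJ, hsJ, hIJ, η, hη⟩ := extend_finset ξ S (by
    intro x hx
    have hx' : x ∈ IsLocalRing.maximalIdeal R := hS ▸ Ideal.subset_span hx
    exact tors_of_dimLt x d M (dimLt_of_moduleDim M d hd x hx') d le_rfl)
  have hmJ : IsLocalRing.maximalIdeal R ≤ J.radical := by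
    rw [← hS]
    exact Ideal.span_le.2 hsJ
  have haI : a ≤ I'.radical := by
    rcases Nat.eq_zero_or_pos t with rfl | ht
    · rw [pow_zero, Ideal.one_eq_top] at hr
      exact le_top.trans hr
    · rw [← Ideal.radical_le_radical_iff, Ideal.radical_pow a ht.ne'] at hr
      exact Ideal.le_radical.trans hr
  obtain ⟨s₁, hs₁⟩ := Ideal.exists_pow_le_of_le_radical_of_fg haI (IsNoetherian.noetherian a)
  obtain ⟨k, hk⟩ := Ideal.exists_pow_le_of_le_radical_of_fg hmJ
    (IsNoetherian.noetherian (IsLocalRing.maximalIdeal R))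
  have hs : a ^ (s₁ + k + t) ≤ I' := (Ideal.pow_le_pow_right (by lia)).trans hs₁
  have hsm : a ^ (s₁ + k + t) ≤ IsLocalRing.maximalIdeal R ^ k :=
    (Ideal.pow_le_pow_right (by lia)).trans (Ideal.pow_right_mono ha k)
  refine ⟨s₁ + k + t, k, hs.trans hI', by lia, by lia, hsm, res hk η, ?_⟩
  rw [res_res, ← res_res hs hJ, hη, res_res]

end LCSurj

namespace LCSurj

open Opposite localCohomology

variable {R : Type u} [CommRing R]

lemma transfer {X₁ Y : ModuleCat.{u} R} (n : ℕ)
    (ξ : ((Ext R (ModuleCat.{u} R) n).obj (op X₁)).obj Y) :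
    ∃ ξ' : Abelian.Ext X₁ Y n, ∀ (X X₂ : ModuleCat.{u} R) (g₁ : X ⟶ X₁) (g₂ : X ⟶ X₂)
      (η' : Abelian.Ext X₂ Y n),
      (Abelian.Ext.mk₀ g₂).comp η' (zero_add n) = (Abelian.Ext.mk₀ g₁).comp ξ' (zero_add n) →
      ∃ η : ((Ext R (ModuleCat.{u} R) n).obj (op X₂)).obj Y,
        (((Ext R (ModuleCat.{u} R) n).map g₂.op).app Y).hom η =
          (((Ext R (ModuleCat.{u} R) n).map g₁.op).app Y).hom ξ := by
  let P₁ := ProjectiveResolution.of X₁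
  obtain ⟨f, hf, hfξ⟩ := rel_surj P₁ n ξ
  refine ⟨P₁.extMk f (n + 1) rfl hf, fun X X₂ g₁ g₂ η' h => ?_⟩
  let P := ProjectiveResolution.of X
  let P₂ := ProjectiveResolution.of X₂
  obtain ⟨e, he, rfl⟩ := P₂.extMk_surjective η' (n + 1) rfl
  obtain ⟨η, hη⟩ := rel_exists P₂ n e he
  refine ⟨η, ?_⟩
  let φ₁ : ProjectiveResolution.Hom P P₁ g₁ :=
    { hom := ProjectiveResolution.lift g₁ P P₁
      hom_f_zero_comp_π_f_zero := ProjectiveResolution.lift_commutes_zero _ _ _ }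
  let φ₂ : ProjectiveResolution.Hom P P₂ g₂ :=
    { hom := ProjectiveResolution.lift g₂ P P₂
      hom_f_zero_comp_π_f_zero := ProjectiveResolution.lift_commutes_zero _ _ _ }
  rw [ProjectiveResolution.mk₀_comp_extMk _ _ _ _ φ₁,
    ProjectiveResolution.mk₀_comp_extMk _ _ _ _ φ₂] at h
  exact rel_unique P n (rel_map g₂ φ₂ n hη) (rel_map g₁ φ₁ n hfξ) (extMk_eq P n _ _ _ _ h)

lemma zero_of_subsingleton {X Y : ModuleCat.{u} R} [Subsingleton X] (n : ℕ)
    (ξ ζ : ((Ext R (ModuleCat.{u} R) n).obj (op X)).obj Y) : ξ = ζ := by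
  let P := ProjectiveResolution.of X
  obtain ⟨f, hf, hfξ⟩ := rel_surj P n ξ
  obtain ⟨g, hg, hgζ⟩ := rel_surj P n ζ
  refine rel_unique P n hfξ hgζ (extMk_eq P n _ _ hf hg ?_)
  have hz : 𝟙 X = 0 := by
    ext m
    exact Subsingleton.elim _ _
  rw [← Abelian.Ext.mk₀_id_comp (P.extMk f _ _ hf), ← Abelian.Ext.mk₀_id_comp (P.extMk g _ _ hg),
    hz, Abelian.Ext.mk₀_zero, Abelian.Ext.zero_comp, Abelian.Ext.zero_comp]

/-- Projections `R/a^t → R/b^t`. -/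
noncomputable def powNat {a b : Ideal R} (h : a ≤ b) :
    ringModIdeals (idealPowersDiagram a) ⟶ ringModIdeals (idealPowersDiagram b) where
  app t := qmap (Ideal.pow_right_mono h (unop t))
  naturality s t f := by
    have h1 : a ^ unop s ≤ a ^ unop t := ((idealPowersDiagram a).map f).down.down
    have h2 : b ^ unop s ≤ b ^ unop t := ((idealPowersDiagram b).map f).down.down
    change qmap h1 ≫ qmap _ = qmap _ ≫ qmap h2
    rw [qmap_comp, qmap_comp]

/-- The map of diagrams. -/
noncomputable def diagMap {a b : Ideal R} (h : a ≤ b) (i : ℕ) :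
    diagram (idealPowersDiagram b) i ⟶ diagram (idealPowersDiagram a) i :=
  Functor.whiskerRight (NatTrans.op (powNat h)) (Ext R (ModuleCat.{u} R) i)

/-- The structure maps of local cohomology. -/
noncomputable def lcι (a : Ideal R) (i t : ℕ) :
    (Ext R (ModuleCat.{u} R) i).obj (op (ModuleCat.of R (R ⧸ a ^ t))) ⟶ localCohomology a i :=
  colimit.ι (diagram (idealPowersDiagram a) i) (op (op t))

/-- The induced map. -/
noncomputable def lcMap {a b : Ideal R} (h : a ≤ b) (i : ℕ) :
    localCohomology b i ⟶ localCohomology a i :=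
  colimMap (diagMap h i)

lemma lcι_map {a b : Ideal R} (h : a ≤ b) (i t : ℕ) :
    lcι b i t ≫ lcMap h i =
      (Ext R (ModuleCat.{u} R) i).map (qmap (Ideal.pow_right_mono h t)).op ≫ lcι a i t :=
  ι_colimMap (diagMap h i) (op (op t))

lemma lcι_w (a : Ideal R) (i : ℕ) {s t : ℕ} (hst : t ≤ s) :
    (Ext R (ModuleCat.{u} R) i).map (qmap (Ideal.pow_le_pow_right (I := a) hst)).op ≫ lcι a i s =
      lcι a i t :=
  colimit.w (diagram (idealPowersDiagram a) i) (homOfLE hst).op.op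

lemma lcι_rep (a : Ideal R) (i : ℕ) (Y : ModuleCat.{u} R) (z : (localCohomology a i).obj Y) :
    ∃ (t : ℕ) (ξ : ((Ext R (ModuleCat.{u} R) i).obj
      (op (ModuleCat.of R (R ⧸ a ^ t)))).obj Y), ((lcι a i t).app Y).hom ξ = z := by
  have : PreservesFilteredColimitsOfSize.{0, 0} (forget (ModuleCat.{u} R)) :=
    preservesFilteredColimitsOfSize_shrink.{0, u, 0, u} _
  obtain ⟨j, ξ, h⟩ := Concrete.isColimit_exists_rep _
    (isColimitOfPreserves ((evaluation (ModuleCat.{u} R) (ModuleCat.{u} R)).obj Y)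
      (colimit.isColimit (diagram (idealPowersDiagram a) i))) z
  exact ⟨unop (unop j), ξ, h⟩

end LCSurj


/-- `H^d_a(M)` is a homomorphic image of the top local cohomology module
`H^d_m(M)`: there is a surjection `H^d_m(M) ↠ H^d_a(M)`. -/
theorem exists_surjective_from_top_localCohomology (R : Type u) [CommRing R]
    [IsNoetherianRing R] [IsLocalRing R] (a : Ideal R)
    (M : Type u) [AddCommGroup M] [Module R M] [Module.Finite R M]
    (d : ℕ) (hd : moduleDim R M = (d : ℕ∞)) :
    ∃ φ : ((localCohomology (IsLocalRing.maximalIdeal R) d).obj (ModuleCat.of R M)) →ₗ[R]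
        ((localCohomology a d).obj (ModuleCat.of R M)),
      Function.Surjective φ := by
  by_cases hat : a = ⊤
  · refine ⟨0, fun z => ⟨0, ?_⟩⟩
    obtain ⟨t, ξ, rfl⟩ := LCSurj.lcι_rep a d (ModuleCat.of R M) z
    have hs : Subsingleton (R ⧸ a ^ t) := by
      rw [Ideal.Quotient.subsingleton_iff, hat, Ideal.top_pow]
    have : Subsingleton (ModuleCat.of R (R ⧸ a ^ t)) := hs
    rw [LCSurj.zero_of_subsingleton d ξ 0, map_zero, map_zero]
  · have ha : a ≤ IsLocalRing.maximalIdeal R := IsLocalRing.le_maximalIdeal hat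
    refine ⟨((LCSurj.lcMap ha d).app (ModuleCat.of R M)).hom, fun z => ?_⟩
    obtain ⟨t, ξ, rfl⟩ := LCSurj.lcι_rep a d (ModuleCat.of R M) z
    obtain ⟨ξ', hξ'⟩ := LCSurj.transfer d ξ
    obtain ⟨s, k, h, hks, hts, h', η', hη'⟩ := LCSurj.key_ext M d hd a ha t ξ'
    obtain ⟨η, hη⟩ := hξ' _ _ (LCSurj.qmap h) (LCSurj.qmap h') η' hη'
    refine ⟨((LCSurj.lcι (IsLocalRing.maximalIdeal R) d k).app (ModuleCat.of R M)).hom η, ?_⟩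
    have e1 : LCSurj.lcι (IsLocalRing.maximalIdeal R) d k ≫ LCSurj.lcMap ha d =
        (Ext R (ModuleCat.{u} R) d).map (LCSurj.qmap h').op ≫ LCSurj.lcι a d s := by
      rw [LCSurj.lcι_map, ← LCSurj.lcι_w a d hks, ← Category.assoc, ← Functor.map_comp, ← op_comp,
        LCSurj.qmap_comp]
    have e2 := congrArg (fun α => (α.app (ModuleCat.of R M)).hom η) e1
    have e3 := congrArg (fun α => (α.app (ModuleCat.of R M)).hom ξ) (LCSurj.lcι_w a d hts)
    refine Eq.trans e2 (Eq.trans ?_ e3)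
    exact congrArg (((LCSurj.lcι a d s).app (ModuleCat.of R M)).hom) hη
end

section
/- Let (R, m) be a Noetherian complete local ring admitting a normalized dualizing complex, and M a finitely generated R-module of dimension d. Then Att_R(H^d_m(M)) = Assh_R(M) := {p ∈ Supp(M) | dim R/p = d}. -/
open CategoryTheory CategoryTheory.Limits DirectSum TensorProduct

universe u

/-- `p` is an attached prime of the `R`-module `M`. -/
def IsAttachedPrime (R : Type u) [CommRing R] (M : Type u) [AddCommGroup M] [Module R M]
    (p : Ideal R) : Prop :=
  p.IsPrime ∧ ∃ N : Submodule R M, Module.annihilator R (M ⧸ N) = p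

/-- The set of attached primes of `M`. -/
def attachedPrimes (R : Type u) [CommRing R] (M : Type u) [AddCommGroup M] [Module R M] :
    Set (Ideal R) :=
  {p | IsAttachedPrime R M p}

namespace TopLC
open Opposite


section ExtCompare
lemma conj_aux {C : Type*} [Category C] {A B A' B' : C} (a : A ≅ B) (b : A' ≅ B') (f : B ⟶ B')
    (g : A ⟶ A') (h : a.hom ≫ f = g ≫ b.hom) : f ≫ b.inv = a.inv ≫ g := by
  rw [Iso.comp_inv_eq, Category.assoc, ← h, Iso.inv_hom_id_assoc]

lemma glue_aux {C : Type*} [Category C] {A B D E F G : C} {a : A ⟶ B} {b : B ⟶ D} {c : A ⟶ E}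
    {d : E ⟶ D} {e : D ⟶ F} {f : E ⟶ G} {g : G ⟶ F} (h : a ≫ b = c ≫ d) (h' : d ≫ e = f ≫ g) :
    a ≫ b ≫ e = (c ≫ f) ≫ g := by
  rw [reassoc_of% h, h', Category.assoc]

variable {R : Type u} [CommRing R]

variable {X Y : ModuleCat.{u} R} (P : ProjectiveResolution X) (n : ℕ)

/-- cocycles -/
noncomputable def Zc (Y : ModuleCat.{u} R) : Submodule R (P.complex.X n ⟶ Y) :=
  LinearMap.ker (Linear.leftComp R Y (P.complex.d (n+1) n))

lemma mem_Zc {f : P.complex.X n ⟶ Y} : f ∈ Zc P n Y ↔ P.complex.d (n+1) n ≫ f = 0 := Iff.rfl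

lemma Zc_prop (f : Zc P n Y) : P.complex.d (n+1) n ≫ f.1 = 0 := f.2

noncomputable def toAb (Y : ModuleCat.{u} R) : Zc P n Y →ₗ[R] Abelian.Ext X Y n where
  toFun f := P.extMk f.1 (n+1) rfl (Zc_prop P n f)
  map_add' f g := (P.add_extMk f.1 g.1 (n+1) rfl (Zc_prop P n f) (Zc_prop P n g)).symm
  map_smul' r f := by
    rw [RingHom.id_apply, Abelian.Ext.smul_eq_comp_mk₀, P.extMk_comp_mk₀]
    simp

lemma toAb_surj : Function.Surjective (toAb P n Y) := by
  intro α
  obtain ⟨f, hf, h⟩ := P.extMk_surjective α (n+1) rfl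
  exact ⟨⟨f, hf⟩, h⟩

lemma toAb_zero_iff_succ (f : Zc P (n+1) Y) : toAb P (n+1) Y f = 0 ↔
   ∃ g : P.complex.X n ⟶ Y, P.complex.d (n+1) n ≫ g = f.1 :=
  P.extMk_eq_zero_iff f.1 (n+2) rfl (Zc_prop P _ f) n rfl

lemma toAb_zero_iff_zero (f : Zc P 0 Y) : toAb P 0 Y f = 0 ↔ f.1 = 0 := by
  constructor
  · intro h
    change P.extMk f.1 1 rfl (Zc_prop P _ f) = 0 at h
    simp only [← P.extEquivCohomologyClass.apply_eq_iff_eq,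
      ProjectiveResolution.extEquivCohomologyClass_extMk,
      ProjectiveResolution.extEquivCohomologyClass_zero,
      CochainComplex.HomComplex.CohomologyClass.mk_eq_zero_iff] at h
    rw [CochainComplex.HomComplex.Cocycle.toSingleMk_mem_coboundaries_iff _ _ _ _ _ (1) (by simp)] at h
    obtain ⟨g, hg⟩ := h
    have hz : IsZero (P.cochainComplex.X 1) := P.cochainComplex.isZero_of_isStrictlyLE 0 1
    have : g = 0 := hz.eq_of_src _ _
    rw [this, comp_zero] at hg
    rw [← cancel_epi (P.cochainComplexXIso (-((0:ℕ):ℤ)) 0 rfl).hom]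
    rw [← hg]; simp
  · intro h
    have : f = 0 := Subtype.ext h
    rw [this, map_zero]

lemma d_hom_apply (f : P.complex.X n ⟶ Y) (m : ℕ) :
   ((P.complex.linearYonedaObj R Y).d n m).hom f = P.complex.d m n ≫ f := by
  rfl

noncomputable def cyc (Y : ModuleCat.{u} R) : ModuleCat.of R (Zc P n Y) ⟶ (P.complex.linearYonedaObj R Y).cycles n :=
  (P.complex.linearYonedaObj R Y).liftCycles (A := ModuleCat.of R (Zc P n Y))
    (ModuleCat.ofHom (Zc P n Y).subtype) (n+1) (by simp) (by
      ext f
      exact Zc_prop P n f)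

lemma cyc_i : cyc P n Y ≫ (P.complex.linearYonedaObj R Y).iCycles n = (ModuleCat.ofHom (Zc P n Y).subtype) := by
  exact HomologicalComplex.liftCycles_i _ _ _ _ _

lemma cyc_bij : Function.Bijective (cyc P n Y).hom := by
  have hi : Function.Injective ((P.complex.linearYonedaObj R Y).iCycles n).hom :=
      (ModuleCat.mono_iff_injective _).1 inferInstance
  constructor
  · have : Function.Injective ((P.complex.linearYonedaObj R Y).iCycles n ∘ (cyc P n Y)) := by
      have h := cyc_i P n (Y := Y)
      have h2 := congrArg (fun k => (k.hom : _ → _)) h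
      dsimp at h2
      rw [h2]
      exact Subtype.val_injective
    exact this.of_comp
  · intro z
    have hz : ((P.complex.linearYonedaObj R Y).d n (n+1)).hom (((P.complex.linearYonedaObj R Y).iCycles n).hom z) = 0 := by
      rw [← LinearMap.comp_apply, ← ModuleCat.hom_comp, HomologicalComplex.iCycles_d]; rfl
    refine ⟨⟨((P.complex.linearYonedaObj R Y).iCycles n).hom z, hz⟩, hi ?_⟩
    exact congrArg (fun k => k.hom ⟨((P.complex.linearYonedaObj R Y).iCycles n).hom z, hz⟩) (cyc_i P n (Y := Y))

/-- to homology -/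
noncomputable def toHo (Y : ModuleCat.{u} R) : Zc P n Y →ₗ[R] (P.complex.linearYonedaObj R Y).homology n :=
  (cyc P n Y ≫ (P.complex.linearYonedaObj R Y).homologyπ n).hom

lemma toHo_surj : Function.Surjective (toHo P n Y) := by
  have : Function.Surjective ((P.complex.linearYonedaObj R Y).homologyπ n).hom :=
    (ModuleCat.epi_iff_surjective _).1 inferInstance
  exact this.comp (cyc_bij P n).2

lemma toHo_zero_iff (f : Zc P n Y) : toHo P n Y f = 0 ↔
   ∃ g, ((P.complex.linearYonedaObj R Y).d ((ComplexShape.up ℕ).prev n) n).hom g = f.1 := by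
  have hi : Function.Injective ((P.complex.linearYonedaObj R Y).iCycles n).hom :=
      (ModuleCat.mono_iff_injective _).1 inferInstance
  have ex : (ShortComplex.mk _ _ ((P.complex.linearYonedaObj R Y).toCycles_comp_homologyπ ((ComplexShape.up ℕ).prev n) n)).Exact :=
    ShortComplex.exact_of_g_is_cokernel _ ((P.complex.linearYonedaObj R Y).homologyIsCokernel _ n rfl)
  rw [ShortComplex.moduleCat_exact_iff] at ex
  have key : ∀ g, ((P.complex.linearYonedaObj R Y).iCycles n).hom (((P.complex.linearYonedaObj R Y).toCycles ((ComplexShape.up ℕ).prev n) n).hom g) =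
      ((P.complex.linearYonedaObj R Y).d ((ComplexShape.up ℕ).prev n) n).hom g := fun g => by
    rw [← LinearMap.comp_apply, ← ModuleCat.hom_comp, HomologicalComplex.toCycles_i]
  have key2 : ((P.complex.linearYonedaObj R Y).iCycles n).hom ((cyc P n Y).hom f) = f.1 :=
    congrArg (fun k => k.hom f) (cyc_i P n (Y := Y))
  constructor
  · intro h
    obtain ⟨g, hg⟩ := ex ((cyc P n Y).hom f) h
    refine ⟨g, ?_⟩
    rw [← key, ← key2]
    exact congrArg _ hg
  · rintro ⟨g, hg⟩
    have : (cyc P n Y).hom f = ((P.complex.linearYonedaObj R Y).toCycles ((ComplexShape.up ℕ).prev n) n).hom g := by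
      apply hi
      rw [key, key2, hg]
    change ((P.complex.linearYonedaObj R Y).homologyπ n).hom ((cyc P n Y).hom f) = 0
    rw [this, ← LinearMap.comp_apply, ← ModuleCat.hom_comp, HomologicalComplex.toCycles_comp_homologyπ]
    rfl

lemma ker_eq : LinearMap.ker (toAb P n Y) = LinearMap.ker (toHo P n Y) := by
  ext f
  rw [LinearMap.mem_ker, LinearMap.mem_ker, toHo_zero_iff]
  cases n with
  | zero =>
    rw [toAb_zero_iff_zero]
    have : (P.complex.linearYonedaObj R Y).d ((ComplexShape.up ℕ).prev 0) 0 = 0 :=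
      HomologicalComplex.shape _ _ _ (by simp)
    rw [this]
    constructor
    · intro h; exact ⟨0, by rw [h]; rfl⟩
    · rintro ⟨g, hg⟩; rw [← hg]; rfl
  | succ n =>
    rw [toAb_zero_iff_succ]
    rw [CochainComplex.prev_nat_succ]
    rfl

noncomputable def extEquivHo (Y : ModuleCat.{u} R) :
   Abelian.Ext X Y n ≃ₗ[R] (P.complex.linearYonedaObj R Y).homology n :=
  ((toAb P n Y).quotKerEquivOfSurjective (toAb_surj P n)).symm ≪≫ₗ
  (Submodule.quotEquivOfEq _ _ (ker_eq P n)) ≪≫ₗ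
   ((toHo P n Y).quotKerEquivOfSurjective (toHo_surj P n))

lemma extEquivHo_apply (f : Zc P n Y) : extEquivHo P n Y (toAb P n Y f) = toHo P n Y f := by
  have : ((toAb P n Y).quotKerEquivOfSurjective (toAb_surj P n)).symm (toAb P n Y f) = Submodule.Quotient.mk f := by
    rw [LinearEquiv.symm_apply_eq]; rfl
  simp only [extEquivHo, LinearEquiv.trans_apply, this]
  rfl

/-- comparison -/
noncomputable def extCmp (Y : ModuleCat.{u} R) :
   Abelian.Ext X Y n ≃ₗ[R] ((Ext R (ModuleCat.{u} R) n).obj (op X)).obj Y :=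
  extEquivHo P n Y ≪≫ₗ (P.isoExt n Y).toLinearEquiv.symm

section nat
variable {X' : ModuleCat.{u} R} (P' : ProjectiveResolution X') (g : X' ⟶ X)

noncomputable def mapZc (φ : P'.complex ⟶ P.complex) (f : Zc P n Y) : Zc P' n Y :=
  ⟨φ.f n ≫ f.1, by
    rw [mem_Zc, ← φ.comm_assoc, Zc_prop P n f, comp_zero]⟩

lemma toAb_nat (φ : P'.complex ⟶ P.complex) (h : φ.f 0 ≫ P.π.f 0 = P'.π.f 0 ≫ g)
   (f : Zc P n Y) : (Abelian.Ext.mk₀ g).comp (toAb P n Y f) (zero_add _) = toAb P' n Y (mapZc P n P' φ f) :=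
  ProjectiveResolution.mk₀_comp_extMk (R := P) f.1 (n+1) rfl (Zc_prop P n f) (R' := P') (g := g) ⟨φ, by simpa using h⟩

noncomputable def homMap (φ : P'.complex ⟶ P.complex) : P.complex.linearYonedaObj R Y ⟶ P'.complex.linearYonedaObj R Y where
  f i := ModuleCat.ofHom (Linear.leftComp R Y (φ.f i))
  comm' i j _ := by
    ext f
    exact (φ.comm_assoc j i f).symm

lemma toHo_nat (φ : P'.complex ⟶ P.complex)
   (f : Zc P n Y) : (HomologicalComplex.homologyMap (homMap P P' φ) n).hom (toHo P n Y f) = toHo P' n Y (mapZc P n P' φ f) := by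
  have hi : Function.Injective ((P'.complex.linearYonedaObj R Y).iCycles n).hom :=
      (ModuleCat.mono_iff_injective _).1 inferInstance
  have h1 : (HomologicalComplex.cyclesMap (homMap P P' φ) n).hom ((cyc P n Y).hom f) = (cyc P' n Y).hom (mapZc P n P' φ f) := by
    apply hi
    have h3 : ((P'.complex.linearYonedaObj R Y).iCycles n).hom ((cyc P' n Y).hom (mapZc P n P' φ f)) = (mapZc P n P' φ f).1 :=
      congrArg (fun k => k.hom (mapZc P n P' φ f)) (cyc_i P' n (Y := Y))
    have key2 : ((P.complex.linearYonedaObj R Y).iCycles n).hom ((cyc P n Y).hom f) = f.1 :=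
      congrArg (fun k => k.hom f) (cyc_i P n (Y := Y))
    rw [h3, ← LinearMap.comp_apply, ← ModuleCat.hom_comp, HomologicalComplex.cyclesMap_i, ModuleCat.hom_comp, LinearMap.comp_apply, key2]
    rfl
  change (HomologicalComplex.homologyMap (homMap P P' φ) n).hom (((P.complex.linearYonedaObj R Y).homologyπ n).hom ((cyc P n Y).hom f)) =
    ((P'.complex.linearYonedaObj R Y).homologyπ n).hom ((cyc P' n Y).hom (mapZc P n P' φ f))
  rw [← h1, ← LinearMap.comp_apply, ← ModuleCat.hom_comp, ← LinearMap.comp_apply, ← ModuleCat.hom_comp, HomologicalComplex.homologyπ_naturality]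
  rfl

lemma isoExt_nat (φ : P'.complex ⟶ P.complex) (h : φ.f 0 ≫ P.π.f 0 = P'.π.f 0 ≫ g) :
   ((Ext R (ModuleCat.{u} R) n).map g.op).app Y ≫ (P'.isoExt n Y).hom =
     (P.isoExt n Y).hom ≫ HomologicalComplex.homologyMap (homMap P P' φ) n := by
  have h1 := ProjectiveResolution.isoLeftDerivedObj_inv_naturality g P' P φ h ((linearYoneda R (ModuleCat.{u} R)).obj Y).rightOp n
  have h1' : ((((linearYoneda R (ModuleCat.{u} R)).obj Y).rightOp.leftDerived n).map g).unop ≫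
      (P'.isoLeftDerivedObj ((linearYoneda R (ModuleCat.{u} R)).obj Y).rightOp n).inv.unop =
      (P.isoLeftDerivedObj ((linearYoneda R (ModuleCat.{u} R)).obj Y).rightOp n).inv.unop ≫
      (HomologicalComplex.homologyMap ((((linearYoneda R (ModuleCat.{u} R)).obj Y).rightOp.mapHomologicalComplex _).map φ) n).unop := congrArg Quiver.Hom.unop h1
  have h2 := HomologicalComplex.homologyOp_hom_naturality (homMap P P' φ (Y := Y)) n
  have h3 : (HomologicalComplex.homologyMap ((((linearYoneda R (ModuleCat.{u} R)).obj Y).rightOp.mapHomologicalComplex _).map φ) n).unop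
      ≫ (HomologicalComplex.homologyUnop _ n).inv = (HomologicalComplex.homologyUnop _ n).inv ≫ HomologicalComplex.homologyMap (homMap P P' φ (Y := Y)) n := by
    exact conj_aux _ _ _ _ (congrArg Quiver.Hom.unop h2)
  change ((((linearYoneda R (ModuleCat.{u} R)).obj Y).rightOp.leftDerived n).map g).unop ≫
      (P'.isoLeftDerivedObj ((linearYoneda R (ModuleCat.{u} R)).obj Y).rightOp n).inv.unop ≫ (HomologicalComplex.homologyUnop _ n).inv =
      ((P.isoLeftDerivedObj ((linearYoneda R (ModuleCat.{u} R)).obj Y).rightOp n).inv.unop ≫ (HomologicalComplex.homologyUnop _ n).inv) ≫ _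
  exact glue_aux h1' h3

lemma extCmp_nat (α : Abelian.Ext X Y n) :
    extCmp P' n Y ((Abelian.Ext.mk₀ g).comp α (zero_add _)) =
     (((Ext R (ModuleCat.{u} R) n).map g.op).app Y).hom (extCmp P n Y α) := by
  obtain ⟨f, rfl⟩ := toAb_surj P n α
  have hl := ProjectiveResolution.lift_commutes_zero g P' P
  set φ := ProjectiveResolution.lift g P' P
  rw [toAb_nat P n P' g φ hl]
  simp only [extCmp, LinearEquiv.trans_apply, extEquivHo_apply]
  rw [LinearEquiv.symm_apply_eq, ← toHo_nat]
  have h := isoExt_nat P n P' g (Y := Y) φ hl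
  have h2 := congrArg (fun k => k.hom ((P.isoExt n Y).toLinearEquiv.symm (toHo P n Y f))) h
  refine Eq.trans ?_ h2.symm
  change _ = (HomologicalComplex.homologyMap (homMap P P' φ) n).hom ((P.isoExt n Y).toLinearEquiv ((P.isoExt n Y).toLinearEquiv.symm (toHo P n Y f)))
  rw [LinearEquiv.apply_symm_apply]
end nat
end ExtCompare

section Model
variable {R : Type u} [CommRing R] (I : Ideal R)

/-- `R/I^t` -/
noncomputable abbrev Xq (t : ℕ) : ModuleCat.{u} R :=
  (localCohomology.ringModIdeals (localCohomology.idealPowersDiagram I)).obj (op t)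

noncomputable abbrev tr {s t : ℕ} (h : s ≤ t) : Xq I t ⟶ Xq I s :=
  (localCohomology.ringModIdeals (localCohomology.idealPowersDiagram I)).map (homOfLE h).op

lemma tr_self (s : ℕ) : tr I (le_refl s) = 𝟙 _ := by
  have : (homOfLE (le_refl s)).op = 𝟙 (op s) := rfl
  rw [tr, this, CategoryTheory.Functor.map_id]

lemma tr_comp {s t v : ℕ} (h : s ≤ t) (h' : t ≤ v) : tr I h' ≫ tr I h = tr I (h.trans h') := by
  rw [tr, tr, ← Functor.map_comp]; rfl

/-- transition maps -/
noncomputable def trExt (M : ModuleCat.{u} R) (n : ℕ) (s t : ℕ) (h : s ≤ t) :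
    Abelian.Ext (Xq I s) M n →ₗ[R] Abelian.Ext (Xq I t) M n :=
  Abelian.Ext.precompOfLinear (Abelian.Ext.mk₀ (tr I h)) R M (zero_add n)

lemma trExt_apply (M : ModuleCat.{u} R) (n : ℕ) (s t : ℕ) (h : s ≤ t) (α) :
   trExt I M n s t h α = (Abelian.Ext.mk₀ (tr I h)).comp α (zero_add n) := rfl

instance (M : ModuleCat.{u} R) (n : ℕ) : DirectedSystem (fun t => Abelian.Ext (Xq I t) M n) (fun s t h => trExt I M n s t h) where
  map_self s x := by
    rw [trExt_apply, tr_self, Abelian.Ext.mk₀_id_comp]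
  map_map i j k hij hjk x := by
    rw [trExt_apply, trExt_apply, trExt_apply, ← tr_comp I hij hjk, Abelian.Ext.mk₀_comp_mk₀_assoc]

/-- local cohomology model -/
noncomputable def LC (n : ℕ) (M : Type u) [AddCommGroup M] [Module R M] : Type u :=
  Module.DirectLimit (fun t => Abelian.Ext (Xq I t) (ModuleCat.of R M) n) (trExt I (ModuleCat.of R M) n)

variable (n : ℕ) (M : Type u) [AddCommGroup M] [Module R M]
noncomputable instance : AddCommGroup (LC I n M) := inferInstanceAs (AddCommGroup (Module.DirectLimit _ _))
noncomputable instance : Module R (LC I n M) := inferInstanceAs (Module R (Module.DirectLimit _ _))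

noncomputable def LCof (t : ℕ) : Abelian.Ext (Xq I t) (ModuleCat.of R M) n →ₗ[R] LC I n M :=
  Module.DirectLimit.of R ℕ _ (trExt I (ModuleCat.of R M) n) t

variable {n M} in
lemma LC_ex (z : LC I n M) : ∃ t α, LCof I n M t α = z := Module.DirectLimit.exists_of z

variable {n M} in
lemma LCof_tr {s t : ℕ} (h : s ≤ t) (α) : LCof I n M t (trExt I (ModuleCat.of R M) n s t h α) = LCof I n M s α :=
  Module.DirectLimit.of_f

variable {n M} in
lemma LCof_zero {s : ℕ} {α} (h : LCof I n M s α = 0) : ∃ t, ∃ h : s ≤ t, trExt I (ModuleCat.of R M) n s t h α = 0 :=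
  Module.DirectLimit.of.zero_exact h

noncomputable def LClift {N : Type*} [AddCommGroup N] [Module R N]
   (g : ∀ t, Abelian.Ext (Xq I t) (ModuleCat.of R M) n →ₗ[R] N)
   (h : ∀ s t (h : s ≤ t) α, g t (trExt I (ModuleCat.of R M) n s t h α) = g s α) : LC I n M →ₗ[R] N :=
  Module.DirectLimit.lift R ℕ _ _ g h

lemma LClift_of {N : Type*} [AddCommGroup N] [Module R N]
   (g : ∀ t, Abelian.Ext (Xq I t) (ModuleCat.of R M) n →ₗ[R] N)
   (h : ∀ s t (h : s ≤ t) α, g t (trExt I (ModuleCat.of R M) n s t h α) = g s α) (t α) :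
   LClift I n M g h (LCof I n M t α) = g t α :=
  Module.DirectLimit.lift_of ..

/-- projective resolutions -/
noncomputable def Pr (t : ℕ) : ProjectiveResolution (Xq I t) := projectiveResolution _

noncomputable abbrev Dg : ℕᵒᵖᵒᵖ ⥤ ModuleCat.{u} R ⥤ ModuleCat.{u} R :=
   localCohomology.diagram (localCohomology.idealPowersDiagram I) n

noncomputable def toLC (t : ℕ) : Abelian.Ext (Xq I t) (ModuleCat.of R M) n →ₗ[R]
    (colimit (Dg I n)).obj (ModuleCat.of R M) :=
  ((colimit.ι (Dg I n) (op (op t))).app (ModuleCat.of R M)).hom ∘ₗ (extCmp (Pr I t) n (ModuleCat.of R M)).toLinearMap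

lemma toLC_tr {s t : ℕ} (h : s ≤ t) (α) : toLC I n M t (trExt I (ModuleCat.of R M) n s t h α) = toLC I n M s α := by
  rw [trExt_apply]
  change ((colimit.ι (Dg I n) (op (op t))).app (ModuleCat.of R M)).hom (extCmp (Pr I t) n (ModuleCat.of R M) _) = _
  rw [extCmp_nat (Pr I s)]
  have := colimit.w (Dg I n) (homOfLE h).op.op
  exact congrArg (fun k => (k.app (ModuleCat.of R M)).hom (extCmp (Pr I s) n (ModuleCat.of R M) α)) this

noncomputable def evc : IsColimit (((evaluation _ _).obj (ModuleCat.of R M)).mapCocone (colimit.cocone (Dg I n))) :=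
  isColimitOfPreserves _ (colimit.isColimit _)

noncomputable def fromLCcocone : Cocone (Dg I n ⋙ (evaluation _ _).obj (ModuleCat.of R M)) where
  pt := ModuleCat.of R (LC I n M)
  ι :=
    { app j := ModuleCat.ofHom (LCof I n M j.unop.unop ∘ₗ (extCmp (Pr I j.unop.unop) n (ModuleCat.of R M)).symm.toLinearMap)
      naturality := by
        intro i j f
        apply ModuleCat.hom_ext
        apply LinearMap.ext
        intro x
        obtain ⟨α, rfl⟩ := (extCmp (Pr I i.unop.unop) n (ModuleCat.of R M)).surjective x
        have h : i.unop.unop ≤ j.unop.unop := leOfHom f.unop.unop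
        have e : f = (homOfLE h).op.op := rfl
        have h2 := extCmp_nat (Pr I i.unop.unop) n (Pr I j.unop.unop) (tr I h) α
        change LCof I n M j.unop.unop ((extCmp (Pr I j.unop.unop) n (ModuleCat.of R M)).symm ((((Ext R (ModuleCat.{u} R) n).map (tr I h).op).app (ModuleCat.of R M)).hom ((extCmp (Pr I i.unop.unop) n (ModuleCat.of R M)) α))) =
          LCof I n M i.unop.unop ((extCmp (Pr I i.unop.unop) n (ModuleCat.of R M)).symm (extCmp (Pr I i.unop.unop) n (ModuleCat.of R M) α))
        rw [← h2, LinearEquiv.symm_apply_apply, LinearEquiv.symm_apply_apply]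
        exact LCof_tr I h α }

noncomputable def LCfwd : LC I n M →ₗ[R] (colimit (Dg I n)).obj (ModuleCat.of R M) :=
  LClift I n M (toLC I n M) (fun s t h α => toLC_tr I n M h α)

noncomputable def LCback : (colimit (Dg I n)).obj (ModuleCat.of R M) →ₗ[R] LC I n M :=
  ((evc I n M).desc (fromLCcocone I n M)).hom

lemma LCback_toLC (t : ℕ) (α) : LCback I n M (toLC I n M t α) = LCof I n M t α := by
  have := congrArg (fun k => k.hom (extCmp (Pr I t) n (ModuleCat.of R M) α)) ((evc I n M).fac (fromLCcocone I n M) (op (op t)))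
  refine Eq.trans this ?_
  change LCof I n M t ((extCmp (Pr I t) n (ModuleCat.of R M)).symm (extCmp (Pr I t) n (ModuleCat.of R M) α)) = _
  rw [LinearEquiv.symm_apply_apply]

lemma LCfwd_back : LCfwd I n M ∘ₗ LCback I n M = LinearMap.id := by
  have : ModuleCat.ofHom (LCback I n M) ≫ ModuleCat.ofHom (LCfwd I n M) = 𝟙 _ := by
    apply (evc I n M).hom_ext
    intro j
    apply ModuleCat.hom_ext
    apply LinearMap.ext
    intro x
    obtain ⟨α, rfl⟩ := (extCmp (Pr I j.unop.unop) n (ModuleCat.of R M)).surjective x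
    change LCfwd I n M (LCback I n M (toLC I n M j.unop.unop α)) = toLC I n M j.unop.unop α
    rw [LCback_toLC]
    exact LClift_of ..
  exact congrArg ModuleCat.Hom.hom this

lemma LCback_fwd : LCback I n M ∘ₗ LCfwd I n M = LinearMap.id := by
  ext z
  obtain ⟨t, α, rfl⟩ := LC_ex I z
  change LCback I n M (LClift I n M (toLC I n M) _ (LCof I n M t α)) = LCof I n M t α
  rw [LClift_of, LCback_toLC]

noncomputable def LCequiv0 : LC I n M ≃ₗ[R] (colimit (Dg I n)).obj (ModuleCat.of R M) :=
  LinearEquiv.ofLinearMap _ _ (LCfwd_back I n M) (LCback_fwd I n M)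

noncomputable def LCequiv : LC I n M ≃ₗ[R] (localCohomology I n).obj (ModuleCat.of R M) :=
  LCequiv0 I n M
end Model


section Interface
variable {R : Type u} [CommRing R] (I : Ideal R)
variable {M N K : Type u} [AddCommGroup M] [Module R M] [AddCommGroup N] [Module R N]
  [AddCommGroup K] [Module R K]

/-- postcomposition with an Ext class -/
noncomputable def Lpost {k n n' : ℕ} (β : Abelian.Ext (ModuleCat.of R M) (ModuleCat.of R N) k)
    (h : n + k = n') : LC I n M →ₗ[R] LC I n' N :=
  LClift I n M (fun t => LCof I n' N t ∘ₗ Abelian.Ext.postcompOfLinear β R (Xq I t) h) (by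
    intro s t hst α
    have : Abelian.Ext.postcompOfLinear β R (Xq I t) h (trExt I (ModuleCat.of R M) n s t hst α)
       = trExt I (ModuleCat.of R N) n' s t hst (Abelian.Ext.postcompOfLinear β R (Xq I s) h α) := by
      rw [trExt_apply, trExt_apply]
      exact Abelian.Ext.comp_assoc _ _ _ (zero_add n) h (by omega)
    rw [LinearMap.comp_apply, this, LCof_tr]
    rfl)

lemma Lpost_of {k n n' : ℕ} (β : Abelian.Ext (ModuleCat.of R M) (ModuleCat.of R N) k)
    (h : n + k = n') (t : ℕ) (α) : Lpost I β h (LCof I n M t α) = LCof I n' N t (α.comp β h) :=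
  LClift_of ..

lemma Lpost_comp {k l n n' n'' : ℕ} (β : Abelian.Ext (ModuleCat.of R M) (ModuleCat.of R N) k)
    (h : n + k = n') (γ : Abelian.Ext (ModuleCat.of R N) (ModuleCat.of R K) l)
    (h' : n' + l = n'') (z : LC I n M) :
    Lpost I γ h' (Lpost I β h z) = Lpost I (β.comp γ rfl) (by omega) z := by
  obtain ⟨t, α, rfl⟩ := LC_ex I z
  rw [Lpost_of, Lpost_of, Lpost_of]
  rw [Abelian.Ext.comp_assoc]
  omega

lemma Lpost_zero {k n n' : ℕ} (h : n + k = n') (z : LC I n M) :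
    Lpost I (0 : Abelian.Ext (ModuleCat.of R M) (ModuleCat.of R N) k) h z = 0 := by
  obtain ⟨t, α, rfl⟩ := LC_ex I z
  rw [Lpost_of, Abelian.Ext.comp_zero, map_zero]

/-- functoriality -/
noncomputable def Lmap (n : ℕ) (f : M →ₗ[R] N) : LC I n M →ₗ[R] LC I n N :=
  Lpost I (Abelian.Ext.mk₀ (ModuleCat.ofHom f)) (add_zero n)

lemma Lmap_comp (n : ℕ) (f : M →ₗ[R] N) (g : N →ₗ[R] K) (z : LC I n M) :
    Lmap I n (g ∘ₗ f) z = Lmap I n g (Lmap I n f z) := by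
  obtain ⟨t, α, rfl⟩ := LC_ex I z
  rw [Lmap, Lmap, Lmap, Lpost_of, Lpost_of, Lpost_of, ModuleCat.ofHom_comp, ← Abelian.Ext.mk₀_comp_mk₀,
    Abelian.Ext.comp_assoc]
  omega

lemma Lmap_id (n : ℕ) (z : LC I n M) :
    Lmap I n (LinearMap.id) z = z := by
  obtain ⟨t, α, rfl⟩ := LC_ex I z
  rw [Lmap, Lpost_of, ModuleCat.ofHom_id, Abelian.Ext.comp_mk₀_id]

lemma Lmap_add (n : ℕ) (f g : M →ₗ[R] N) (z : LC I n M) :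
    Lmap I n (f + g) z = Lmap I n f z + Lmap I n g z := by
  obtain ⟨t, α, rfl⟩ := LC_ex I z
  rw [Lmap, Lmap, Lmap, Lpost_of, Lpost_of, Lpost_of, ModuleCat.ofHom_add, Abelian.Ext.mk₀_add,
    Abelian.Ext.comp_add, map_add]

lemma Lmap_smul (n : ℕ) (r : R) (f : M →ₗ[R] N) (z : LC I n M) :
    Lmap I n (r • f) z = r • Lmap I n f z := by
  obtain ⟨t, α, rfl⟩ := LC_ex I z
  have : ModuleCat.ofHom (r • f) = r • ModuleCat.ofHom f := rfl
  rw [Lmap, Lmap, Lpost_of, Lpost_of, this, Abelian.Ext.mk₀_smul,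
    Abelian.Ext.comp_smul, map_smul]

lemma Lmap_zero (n : ℕ) (z : LC I n M) :
    Lmap I n (0 : M →ₗ[R] N) z = 0 := by
  have := Lmap_smul I n 0 (0 : M →ₗ[R] N) z
  rwa [zero_smul, zero_smul] at this

lemma Lmap_sum (n : ℕ) {ι : Type*} (s : Finset ι) (f : ι → (M →ₗ[R] N)) (z : LC I n M) :
    Lmap I n (∑ i ∈ s, f i) z = ∑ i ∈ s, Lmap I n (f i) z := by
  classical
  induction s using Finset.induction_on with
  | empty => simp [Lmap_zero]
  | insert a s ha ih => rw [Finset.sum_insert ha, Finset.sum_insert ha, Lmap_add, ih]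

lemma LC_subsingleton [Subsingleton M] (n : ℕ) : Subsingleton (LC I n M) := by
  refine ⟨fun a b => ?_⟩
  have e : (LinearMap.id : M →ₗ[R] M) = 0 := Subsingleton.elim _ _
  rw [← Lmap_id I n a, ← Lmap_id I n b, e, Lmap_zero, Lmap_zero]

section LES
variable (f : M →ₗ[R] N) (g : N →ₗ[R] K)
/-- the short complex -/
noncomputable def SC (hfg : Function.Exact f g) : ShortComplex (ModuleCat.{u} R) :=
  ShortComplex.mk (ModuleCat.ofHom f) (ModuleCat.ofHom g) (by
    rw [← ModuleCat.ofHom_comp, hfg.linearMap_comp_eq_zero]; rfl)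

lemma SC_exact (hf : Function.Injective f) (hg : Function.Surjective g) (hfg : Function.Exact f g) :
    (SC f g hfg).ShortExact where
  exact := by
    rw [ShortComplex.moduleCat_exact_iff]
    intro x hx
    exact (hfg x).1 hx
  mono_f := (ModuleCat.mono_iff_injective _).2 hf
  epi_g := (ModuleCat.epi_iff_surjective _).2 hg

lemma ext_les (hf : Function.Injective f) (hg : Function.Surjective g) (hfg : Function.Exact f g) :
    ∃ β : Abelian.Ext (ModuleCat.of R K) (ModuleCat.of R M) 1,
     ((Abelian.Ext.mk₀ (ModuleCat.ofHom g)).comp β (zero_add 1) = 0 ∧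
      β.comp (Abelian.Ext.mk₀ (ModuleCat.ofHom f)) (add_zero 1) = 0) ∧ ∀ (X : ModuleCat.{u} R) (n : ℕ),
     (∀ x : Abelian.Ext X (ModuleCat.of R N) n, x.comp (Abelian.Ext.mk₀ (ModuleCat.ofHom g)) (add_zero n) = 0 →
       ∃ y : Abelian.Ext X (ModuleCat.of R M) n, y.comp (Abelian.Ext.mk₀ (ModuleCat.ofHom f)) (add_zero n) = x) ∧
     (∀ x : Abelian.Ext X (ModuleCat.of R K) n, x.comp β rfl = 0 →
       ∃ y : Abelian.Ext X (ModuleCat.of R N) n, y.comp (Abelian.Ext.mk₀ (ModuleCat.ofHom g)) (add_zero n) = x) ∧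
     (∀ x : Abelian.Ext X (ModuleCat.of R M) (n+1), x.comp (Abelian.Ext.mk₀ (ModuleCat.ofHom f)) (add_zero (n+1)) = 0 →
       ∃ y : Abelian.Ext X (ModuleCat.of R K) n, y.comp β rfl = x) := by
  have hS := SC_exact f g hf hg hfg
  refine ⟨hS.extClass, ⟨hS.comp_extClass, hS.extClass_comp⟩, fun X n => ⟨?_, ?_, ?_⟩⟩
  · intro x h
    exact Abelian.Ext.covariant_sequence_exact₂ _ hS _ h
  · intro x h
    exact Abelian.Ext.covariant_sequence_exact₃ _ hS _ _ h
  · intro x h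
    exact Abelian.Ext.covariant_sequence_exact₁ _ hS _ h rfl

theorem LES (hf : Function.Injective f) (hg : Function.Surjective g) (hfg : Function.Exact f g) (n : ℕ) :
    ∃ δ : LC I n K →ₗ[R] LC I (n+1) M, (∀ z, Lmap I n g z = 0 → ∃ w, Lmap I n f w = z) ∧
      (∀ z, δ z = 0 → ∃ w, Lmap I n g w = z) ∧ (∀ z, Lmap I (n+1) f z = 0 → ∃ w, δ w = z) ∧
      (∀ z, δ (Lmap I n g z) = 0) ∧ (∀ z, Lmap I (n+1) f (δ z) = 0) := by
  obtain ⟨β, ⟨hβ1, hβ2⟩, hβ⟩ := ext_les f g hf hg hfg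
  refine ⟨Lpost I β rfl, ?_, ?_, ?_, ?_, ?_⟩
  · intro z hz
    obtain ⟨s, α, rfl⟩ := LC_ex I z
    rw [Lmap, Lpost_of] at hz
    obtain ⟨t, hst, h⟩ := LCof_zero I hz
    rw [trExt_apply, ← Abelian.Ext.comp_assoc (a₁₂ := n) (h₁₂ := zero_add n) (h := by omega)] at h
    obtain ⟨x, hx⟩ := (hβ _ _).1 _ h
    refine ⟨LCof I n M t x, ?_⟩
    rw [Lmap, Lpost_of, hx]
    exact LCof_tr I hst α
  · intro z hz
    obtain ⟨s, α, rfl⟩ := LC_ex I z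
    rw [Lpost_of] at hz
    obtain ⟨t, hst, h⟩ := LCof_zero I hz
    rw [trExt_apply, ← Abelian.Ext.comp_assoc (a₁₂ := n) (h₁₂ := zero_add n) (h := by omega)] at h
    obtain ⟨x, hx⟩ := (hβ _ _).2.1 _ h
    refine ⟨LCof I n N t x, ?_⟩
    rw [Lmap, Lpost_of, hx]
    exact LCof_tr I hst α
  · intro z hz
    obtain ⟨s, α, rfl⟩ := LC_ex I z
    rw [Lmap, Lpost_of] at hz
    obtain ⟨t, hst, h⟩ := LCof_zero I hz
    rw [trExt_apply, ← Abelian.Ext.comp_assoc (a₁₂ := n+1) (h₁₂ := zero_add (n+1)) (h := by omega)] at h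
    obtain ⟨x, hx⟩ := (hβ _ _).2.2 _ h
    refine ⟨LCof I n K t x, ?_⟩
    rw [Lpost_of, hx]
    exact LCof_tr I hst α
  · intro z
    obtain ⟨s, α, rfl⟩ := LC_ex I z
    rw [Lmap, Lpost_of, Lpost_of, Abelian.Ext.comp_assoc (h₂₃ := zero_add 1) (h := by omega), hβ1,
      Abelian.Ext.comp_zero, map_zero]
  · intro z
    obtain ⟨s, α, rfl⟩ := LC_ex I z
    rw [Lmap, Lpost_of, Lpost_of, Abelian.Ext.comp_assoc (h₂₃ := add_zero 1) (h := by omega), hβ2,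
      Abelian.Ext.comp_zero, map_zero]
end LES

/-- torsion -/
def Tors (I : Ideal R) (M : Type*) [AddCommGroup M] [Module R M] : Prop :=
  ∀ x : M, ∃ t : ℕ, ∀ r ∈ I ^ t, r • x = 0

lemma quot_smul_zero (J : Ideal R) (r : R) (hr : r ∈ J) (y : R) :
    r • (Submodule.Quotient.mk y : R ⧸ J) = 0 := by
  rw [← Submodule.Quotient.mk_smul, Submodule.Quotient.mk_eq_zero]
  exact Ideal.mul_mem_right _ _ hr

lemma quot_lin (J : Ideal R) (φ : (R ⧸ J) →ₗ[R] M) (y : R) :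
    φ (Submodule.Quotient.mk y) = y • φ (Submodule.Quotient.mk 1) := by
  rw [← map_smul, ← Submodule.Quotient.mk_smul, smul_eq_mul, mul_one]

lemma Xq_smul (t : ℕ) (r : R) (hr : r ∈ I ^ t) : r • 𝟙 (Xq I t) = 0 := by
  apply ModuleCat.hom_ext
  apply LinearMap.ext
  intro x
  change r • (x : R ⧸ I ^ t) = 0
  obtain ⟨y, rfl⟩ := Submodule.Quotient.mk_surjective _ x
  exact quot_smul_zero _ r hr y

lemma LC_tors (n : ℕ) : Tors I (LC I n M) := by
  intro z
  obtain ⟨t, α, rfl⟩ := LC_ex I z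
  refine ⟨t, fun r hr => ?_⟩
  rw [← map_smul]
  have : r • α = 0 := by
    conv_lhs => rw [← Abelian.Ext.mk₀_id_comp α]
    rw [← Abelian.Ext.smul_comp, ← Abelian.Ext.mk₀_smul, Xq_smul I t r hr, Abelian.Ext.mk₀_zero,
      Abelian.Ext.zero_comp]
  rw [this, map_zero]

lemma LC_injective [Module.Injective R M] (n : ℕ) : Subsingleton (LC I (n+1) M) := by
  have := Module.injective_object_of_injective_module R M
  have key : ∀ a : LC I (n+1) M, a = 0 := by
    intro z
    obtain ⟨t, α, rfl⟩ := LC_ex I z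
    rw [Abelian.Ext.eq_zero_of_injective α, map_zero]
  exact ⟨fun a b => by rw [key a, key b]⟩

/-- surjectivity in degree zero when target is torsion. -/
lemma Lmap_zero_surj (f : M →ₗ[R] N) (hM : Tors I M) (hf : Function.Surjective f) :
    Function.Surjective (Lmap I 0 f) := by
  intro z
  obtain ⟨t, α, rfl⟩ := LC_ex I z
  obtain ⟨φ, rfl⟩ := (Abelian.Ext.mk₀_bijective _ _).2 α
  obtain ⟨x, hx⟩ := hf (φ.hom (Submodule.Quotient.mk (1 : R) : R ⧸ I ^ t))
  obtain ⟨s, hs⟩ := hM x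
  have hle : t ≤ max s t := le_max_right _ _
  let ψ0 : (R ⧸ I ^ (max s t)) →ₗ[R] M := Submodule.liftQ _ (LinearMap.toSpanSingleton R M x) (by
    intro r hr
    exact hs r (Ideal.pow_le_pow_right (le_max_left s t) hr))
  let ψ : Xq I (max s t) ⟶ ModuleCat.of R M := ModuleCat.ofHom ψ0
  have e : tr I hle ≫ φ = ψ ≫ ModuleCat.ofHom f := by
    apply ModuleCat.hom_ext
    apply LinearMap.ext
    intro y
    obtain ⟨y, rfl⟩ := Submodule.Quotient.mk_surjective _ y
    change φ.hom (Submodule.Quotient.mk y : R ⧸ I ^ t) = f (y • x)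
    rw [map_smul, hx]
    exact quot_lin (I ^ t) φ.hom y
  refine ⟨LCof I 0 M (max s t) (Abelian.Ext.mk₀ ψ), ?_⟩
  rw [Lmap, Lpost_of, Abelian.Ext.mk₀_comp_mk₀, ← e, ← LCof_tr I hle, trExt_apply, Abelian.Ext.mk₀_comp_mk₀]

/-- degree zero embeds -/
noncomputable def LCev : LC I 0 M →ₗ[R] M :=
  LClift I 0 M (fun t =>
    { toFun α := (Abelian.Ext.linearEquiv₀ (R := R) α).hom (Submodule.Quotient.mk (1 : R) : R ⧸ I ^ t)
      map_add' a b := by rw [map_add]; rfl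
      map_smul' a b := by rw [map_smul]; rfl }) (by
    intro s t h α
    obtain ⟨φ, rfl⟩ := (Abelian.Ext.mk₀_bijective _ _).2 α
    rw [trExt_apply, Abelian.Ext.mk₀_comp_mk₀]
    have h1 : Abelian.Ext.linearEquiv₀ (R := R) (Abelian.Ext.mk₀ φ) = φ :=
      Abelian.Ext.linearEquiv₀.apply_symm_apply φ
    have h2 : Abelian.Ext.linearEquiv₀ (R := R) (Abelian.Ext.mk₀ (tr I h ≫ φ)) = tr I h ≫ φ :=
      Abelian.Ext.linearEquiv₀.apply_symm_apply _
    change (Abelian.Ext.linearEquiv₀ (R := R) (Abelian.Ext.mk₀ (tr I h ≫ φ))).hom _ =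
      (Abelian.Ext.linearEquiv₀ (R := R) (Abelian.Ext.mk₀ φ)).hom _
    rw [h1, h2]
    rfl)

lemma LCev_of (t : ℕ) (φ : Xq I t ⟶ ModuleCat.of R M) :
   LCev I (LCof I 0 M t (Abelian.Ext.mk₀ φ)) = φ.hom (Submodule.Quotient.mk (1 : R) : R ⧸ I ^ t) := by
  refine (LClift_of ..).trans ?_
  have h1 : Abelian.Ext.linearEquiv₀ (R := R) (Abelian.Ext.mk₀ φ) = φ :=
      Abelian.Ext.linearEquiv₀.apply_symm_apply φ
  change (Abelian.Ext.linearEquiv₀ (R := R) (Abelian.Ext.mk₀ φ)).hom _ = _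
  rw [h1]

lemma LCev_inj : Function.Injective (LCev I (M := M)) := by
  rw [injective_iff_map_eq_zero]
  intro z hz
  obtain ⟨t, α, rfl⟩ := LC_ex I z
  obtain ⟨φ, rfl⟩ := (Abelian.Ext.mk₀_bijective _ _).2 α
  rw [LCev_of] at hz
  have : φ = 0 := by
    apply ModuleCat.hom_ext
    apply LinearMap.ext
    intro y
    obtain ⟨y, rfl⟩ := Submodule.Quotient.mk_surjective _ y
    refine (quot_lin (I ^ t) φ.hom y).trans ?_
    exact (congrArg (y • ·) hz).trans (smul_zero y)
  rw [this, Abelian.Ext.mk₀_zero, map_zero]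

lemma LCev_range (x : M) (t : ℕ) (h : ∀ r ∈ I ^ t, r • x = 0) : ∃ z, LCev I (M := M) z = x := by
  let ψ0 : (R ⧸ I ^ t) →ₗ[R] M := Submodule.liftQ _ (LinearMap.toSpanSingleton R M x) (by
    intro r hr
    exact h r hr)
  let ψ : Xq I t ⟶ ModuleCat.of R M := ModuleCat.ofHom ψ0
  refine ⟨LCof I 0 M t (Abelian.Ext.mk₀ ψ), ?_⟩
  rw [LCev_of]
  change (1 : R) • x = x
  rw [one_smul]

end Interface


section Torsion
variable {R : Type u} [CommRing R] (I : Ideal R)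

/-- torsion submodule -/
def Gam (M : Type*) [AddCommGroup M] [Module R M] : Submodule R M where
  carrier := {x | ∃ t : ℕ, ∀ r ∈ I ^ t, r • x = 0}
  zero_mem' := ⟨0, by simp⟩
  add_mem' := by
    rintro a b ⟨s, hs⟩ ⟨t, ht⟩
    refine ⟨max s t, fun r hr => ?_⟩
    rw [smul_add, hs r (Ideal.pow_le_pow_right (le_max_left s t) hr),
      ht r (Ideal.pow_le_pow_right (le_max_right s t) hr), add_zero]
  smul_mem' := by
    rintro c x ⟨t, ht⟩
    exact ⟨t, fun r hr => by rw [smul_comm, ht r hr, smul_zero]⟩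

lemma mem_Gam {M : Type*} [AddCommGroup M] [Module R M] {x : M} :
  x ∈ Gam I M ↔ ∃ t : ℕ, ∀ r ∈ I ^ t, r • x = 0 := Iff.rfl

lemma Gam_tors (M : Type*) [AddCommGroup M] [Module R M] : Tors I (Gam I M) := by
  rintro ⟨x, t, ht⟩
  exact ⟨t, fun r hr => Subtype.ext (ht r hr)⟩

variable {I} in
lemma Tors.quot {M N : Type*} [AddCommGroup M] [Module R M] [AddCommGroup N] [Module R N] (h : Tors I M)
    (f : M →ₗ[R] N) (hf : Function.Surjective f) : Tors I N := by
  intro y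
  obtain ⟨x, rfl⟩ := hf y
  obtain ⟨t, ht⟩ := h x
  exact ⟨t, fun r hr => by rw [← map_smul, ht r hr, map_zero]⟩

/-- uniform torsion exponent on finite submodules -/
lemma Tors.fg {M : Type*} [AddCommGroup M] [Module R M] (N : Submodule R M) (hN : N.FG)
    (h : N ≤ Gam I M) : ∃ t : ℕ, ∀ r ∈ I ^ t, ∀ x ∈ N, r • x = 0 := by
  classical
  obtain ⟨S, rfl⟩ := hN
  have h' : ∀ x : S, ∃ t : ℕ, ∀ r ∈ I ^ t, r • x.1 = 0 := fun x => h (Submodule.subset_span x.2)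
  choose t ht using h'
  refine ⟨Finset.univ.sup t, fun r hr x hx => ?_⟩
  induction hx using Submodule.span_induction with
  | mem x hx => exact ht ⟨x, hx⟩ r (Ideal.pow_le_pow_right (Finset.le_sup (f := t) (Finset.mem_univ (⟨x, hx⟩ : S))) hr)
  | zero => simp
  | add x y _ _ hx hy => rw [smul_add, hx, hy, add_zero]
  | smul a x _ hx => rw [smul_comm, hx, smul_zero]

instance Gam_injective [IsNoetherianRing R] (E : Type u) [AddCommGroup E] [Module R E] [Module.Injective R E] :
    Module.Injective R (Gam I E) := by
  apply Module.Baer.injective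
  intro J g
  have hJ : J.FG := IsNoetherian.noetherian J
  let N : Submodule R E := LinearMap.range ((Gam I E).subtype ∘ₗ g)
  have hfin : Module.Finite R J := inferInstance
  have hNfg : N.FG := Module.Finite.iff_fg.1 (Module.Finite.range _)
  obtain ⟨t, ht⟩ := Tors.fg I N hNfg (by
    rintro _ ⟨x, rfl⟩
    exact (g x).2)
  obtain ⟨k, hk⟩ := Ideal.exists_pow_inf_eq_pow_smul I J
  have hk' := hk (t + k) (by omega)
  rw [Nat.add_sub_cancel] at hk'
  have hz : ∀ x : J, x.1 ∈ I ^ (t + k) → (g x : E) = 0 := by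
    intro x hx
    have hle : I ^ t • (I ^ k • ⊤ ⊓ J) ≤ I ^ t • J := Submodule.smul_mono le_rfl inf_le_right
    have hx' : x.1 ∈ I ^ t • J := by
      apply hle
      rw [← hk']
      exact ⟨by simpa using hx, x.2⟩
    have key : ∀ y ∈ I ^ t • J, ∀ hy : y ∈ J, (g ⟨y, hy⟩ : E) = 0 := by
      intro y hy
      induction hy using Submodule.smul_induction_on' with
      | smul r hr n hn =>
        intro hy
        have : (⟨r • n, hy⟩ : J) = r • ⟨n, hn⟩ := rfl
        rw [this, map_smul]
        exact ht r hr _ ⟨⟨n, hn⟩, rfl⟩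
      | add x hx y hy h1 h2 =>
        intro hxy
        have hxJ : x ∈ J := Submodule.smul_le_right hx
        have hyJ : y ∈ J := Submodule.smul_le_right hy
        have : (⟨x + y, hxy⟩ : J) = ⟨x, hxJ⟩ + ⟨y, hyJ⟩ := rfl
        rw [this, map_add, Submodule.coe_add, h1, h2, add_zero]
    exact key _ hx' x.2
  let q : J →ₗ[R] R ⧸ I ^ (t + k) := (Submodule.mkQ _) ∘ₗ J.subtype
  have hker : LinearMap.ker q ≤ LinearMap.ker ((Gam I E).subtype ∘ₗ g) := by
    intro x hx
    apply hz
    have : (Submodule.Quotient.mk x.1 : R ⧸ I ^ (t+k)) = 0 := hx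
    rwa [Submodule.Quotient.mk_eq_zero] at this
  have hinj : Function.Injective ((LinearMap.ker q).liftQ q le_rfl) := by
    rw [← LinearMap.ker_eq_bot]
    exact Submodule.ker_liftQ_eq_bot' _ _ rfl
  obtain ⟨φ, hφ⟩ := Module.Injective.out (R := R) (Q := E) ((LinearMap.ker q).liftQ q le_rfl) hinj
     ((LinearMap.ker q).liftQ ((Gam I E).subtype ∘ₗ g) hker)
  have hx : φ (Submodule.Quotient.mk 1) ∈ Gam I E := ⟨t + k, fun r hr => by
    rw [← quot_lin, (Submodule.Quotient.mk_eq_zero _).2 hr, map_zero]⟩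
  refine ⟨LinearMap.toSpanSingleton R _ ⟨_, hx⟩, fun y hy => ?_⟩
  apply Subtype.ext
  have := hφ (Submodule.Quotient.mk ⟨y, hy⟩)
  change φ (Submodule.Quotient.mk y) = g ⟨y, hy⟩ at this
  rw [quot_lin] at this
  rw [← this]
  rfl

lemma exists_inj_emb (M : Type u) [AddCommGroup M] [Module R M] : ∃ (E : Type u) (_ : AddCommGroup E) (_ : Module R E)
    (_ : Module.Injective R E) (ι : M →ₗ[R] E), Function.Injective ι := by
  have : Injective (ModuleCat.of R (Injective.under (ModuleCat.of R M) : ModuleCat.{u} R)) :=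
    inferInstanceAs (Injective (Injective.under (ModuleCat.of R M)))
  exact ⟨(Injective.under (ModuleCat.of R M) : ModuleCat.{u} R), inferInstance, inferInstance,
    Module.injective_module_of_injective_object R _, (Injective.ι (ModuleCat.of R M)).hom,
    (ModuleCat.mono_iff_injective _).1 inferInstance⟩

lemma subsing_of {A : Type*} [AddCommGroup A] (h : ∀ z : A, z = 0) : Subsingleton A :=
  ⟨fun a b => by rw [h a, h b]⟩

theorem V0 [IsNoetherianRing R] (n : ℕ) : ∀ (M : Type u) [AddCommGroup M] [Module R M], Tors I M →
    Subsingleton (LC I (n+1) M) := by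
  induction n with
  | zero =>
    intro M _ _ hM
    obtain ⟨E, _, _, _, ι, hι⟩ := exists_inj_emb (R := R) M
    let j : M →ₗ[R] Gam I E := ι.codRestrict _ (fun x => by
      obtain ⟨t, ht⟩ := hM x
      exact ⟨t, fun r hr => by rw [← map_smul, ht r hr, map_zero]⟩)
    have hj : Function.Injective j := fun a b h => hι (congrArg Subtype.val h)
    obtain ⟨δ, h1, h2, h3, h4, h5⟩ := LES I j (LinearMap.range j).mkQ hj (Submodule.mkQ_surjective _)
      (LinearMap.exact_map_mkQ_range j) 0
    have hs := Lmap_zero_surj I (LinearMap.range j).mkQ (Gam_tors I E) (Submodule.mkQ_surjective _)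
    apply subsing_of
    intro z
    have := LC_injective I (M := Gam I E) 0
    obtain ⟨w, rfl⟩ := h3 z (Subsingleton.elim _ _)
    obtain ⟨v, rfl⟩ := hs w
    exact h4 v
  | succ n ih =>
    intro M _ _ hM
    obtain ⟨E, _, _, _, ι, hι⟩ := exists_inj_emb (R := R) M
    let j : M →ₗ[R] Gam I E := ι.codRestrict _ (fun x => by
      obtain ⟨t, ht⟩ := hM x
      exact ⟨t, fun r hr => by rw [← map_smul, ht r hr, map_zero]⟩)
    have hj : Function.Injective j := fun a b h => hι (congrArg Subtype.val h)
    obtain ⟨δ, h1, h2, h3, h4, h5⟩ := LES I j (LinearMap.range j).mkQ hj (Submodule.mkQ_surjective _)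
      (LinearMap.exact_map_mkQ_range j) (n+1)
    have := ih _ ((Gam_tors I E).quot (LinearMap.range j).mkQ (Submodule.mkQ_surjective _))
    apply subsing_of
    intro z
    have := LC_injective I (M := Gam I E) (n+1)
    obtain ⟨w, rfl⟩ := h3 z (Subsingleton.elim _ _)
    rw [Subsingleton.elim w 0, map_zero]
end Torsion


section Mel
variable {R : Type*} [CommRing R] {H : Type*} [AddCommGroup H] [Module R H]

theorem melkersson (r : R) (hr : ∀ z : H, ∃ k : ℕ, r ^ k • z = 0) (K : Submodule R H) [IsArtinian R K]
    (hK : ∀ z : H, r • z = 0 → z ∈ K) : IsArtinian R H := by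
  rw [← monotone_stabilizes_iff_artinian]
  intro f
  have hf : ∀ {a b : ℕ}, a ≤ b → OrderDual.ofDual (f b) ≤ OrderDual.ofDual (f a) := fun h => f.monotone h
  let N : ℕ → Submodule R H := fun k => OrderDual.ofDual (f k)
  have hN : ∀ {a b : ℕ}, a ≤ b → N b ≤ N a := hf
  let A : ℕ → ℕ → Submodule R K := fun j k =>
    Submodule.comap K.subtype (Submodule.map (LinearMap.lsmul R H (r ^ j)) (N k))
  have memA : ∀ j k (x : K), x ∈ A j k ↔ ∃ y ∈ N k, r ^ j • y = x.1 := fun j k x => Iff.rfl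
  have hA1 : ∀ j {a b : ℕ}, a ≤ b → A j b ≤ A j a := by
    intro j a b h x hx
    rw [memA] at hx ⊢
    obtain ⟨y, hy, e⟩ := hx
    exact ⟨y, hN h hy, e⟩
  have hA2 : ∀ {i j : ℕ} k, i ≤ j → A j k ≤ A i k := by
    intro i j k h x hx
    rw [memA] at hx ⊢
    obtain ⟨y, hy, e⟩ := hx
    refine ⟨r ^ (j - i) • y, (N k).smul_mem _ hy, ?_⟩
    rw [smul_smul, ← pow_add, ← e]
    congr 2; omega
  have key : ∃ b, ∀ j, ∀ k, b ≤ k → A j b ≤ A j k := by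
    obtain ⟨_, ⟨⟨a, b⟩, rfl⟩, hmin⟩ := IsArtinian.set_has_minimal (Set.range (fun p : ℕ × ℕ => A p.1 p.2))
      ⟨_, ⟨(0, 0), rfl⟩⟩
    have hst : ∀ j, ∃ b, ∀ k, b ≤ k → A j b ≤ A j k := by
      intro j
      obtain ⟨n, hn⟩ := IsArtinian.monotone_stabilizes
        (⟨fun k => OrderDual.toDual (A j k), fun a b h => hA1 j h⟩ : ℕ →o (Submodule R K)ᵒᵈ)
      exact ⟨n, fun k hk => le_of_eq (hn k hk)⟩
    choose c hc using hst
    refine ⟨max b ((Finset.range a).sup c), fun j k hk => ?_⟩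
    by_cases hj : j < a
    · have h1 : c j ≤ max b ((Finset.range a).sup c) :=
        (Finset.le_sup (f := c) (Finset.mem_range.2 hj)).trans (le_max_right _ _)
      exact (hA1 j h1).trans (hc j k (h1.trans hk))
    · push Not at hj
      have h1 : A j k ≤ A a b := (hA2 k hj).trans (hA1 a ((le_max_left _ _).trans hk))
      have h2 : A j k = A a b := by
        by_contra hne
        exact hmin _ ⟨(j, k), rfl⟩ (lt_of_le_of_ne h1 hne)
      rw [h2]
      exact (hA2 _ hj).trans (hA1 a (le_max_left _ _))
  obtain ⟨b, hb⟩ := key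
  refine ⟨b, fun k hk => ?_⟩
  change N b = N k
  refine le_antisymm ?_ (hN hk)
  have : ∀ j, ∀ y ∈ N b, r ^ j • y = 0 → y ∈ N k := by
    intro j
    induction j with
    | zero => intro y _ h; rw [pow_zero, one_smul] at h; rw [h]; exact zero_mem _
    | succ j ih =>
      intro y hy h
      have hyK : r ^ j • y ∈ K := hK _ (by rwa [smul_smul, ← pow_succ'])
      have h1 : (⟨r ^ j • y, hyK⟩ : K) ∈ A j b := ⟨y, hy, rfl⟩
      obtain ⟨y', hy', e⟩ := (memA _ _ _).1 (hb j k hk h1)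
      have h2 := ih (y - y') ((N b).sub_mem hy (hN hk hy')) (by rw [smul_sub, e, sub_self])
      have := (N k).add_mem h2 hy'
      rwa [sub_add_cancel] at this
  intro y hy
  obtain ⟨j, hj⟩ := hr y
  exact this j y hy hj
end Mel

section Loc
variable {R : Type u} [CommRing R] [IsNoetherianRing R] [IsLocalRing R]
local notation "𝔪" => IsLocalRing.maximalIdeal R

lemma art_of_killed (X : Type*) [AddCommGroup X] [Module R X] [Module.Finite R X] (t : ℕ)
    (h' : ∀ r ∈ 𝔪 ^ t, ∀ x : X, r • x = 0) : IsArtinian R X := by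
  have h : ∀ r ∈ 𝔪 ^ (t + 1), ∀ x : X, r • x = 0 := fun r hr => h' r (Ideal.pow_le_pow_right (Nat.le_succ t) hr)
  generalize ht : t + 1 = s at h
  have hX : Module.IsTorsionBySet R X (𝔪 ^ s : Ideal R) := fun x a => h a.1 a.2 x
  letI := hX.module
  have : IsScalarTower R (R ⧸ 𝔪 ^ s) X := hX.isScalarTower
  have : Module.Finite (R ⧸ 𝔪 ^ s) X := Module.Finite.of_restrictScalars_finite R _ _
  have hart : IsArtinianRing (R ⧸ 𝔪 ^ s) := by
    apply IsLocalRing.quotient_artinian_of_mem_minimalPrimes_of_isLocalRing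
    refine ⟨⟨inferInstance, ?_⟩, fun q hq _ => ?_⟩
    · rw [← ht]; exact Ideal.pow_le_self (Nat.succ_ne_zero t)
    · have := hq.1
      exact Ideal.IsPrime.le_of_pow_le hq.2
  have : IsArtinian (R ⧸ 𝔪 ^ s) X := inferInstance
  exact isArtinian_of_surjective_algebraMap (R := R ⧸ 𝔪 ^ s) Ideal.Quotient.mk_surjective

lemma exists_reg (M : Type*) [AddCommGroup M] [Module R M] [Module.Finite R M] :
    ∃ r ∈ 𝔪, IsSMulRegular (M ⧸ Gam 𝔪 M) r := by
  by_contra! hcon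
  have hfin := associatedPrimes.finite R (M ⧸ Gam 𝔪 M)
  have hsub : (𝔪 : Set R) ⊆ ⋃ i ∈ ((hfin.toFinset : Finset (Ideal R)) : Set (Ideal R)), (id i : Ideal R) := by
    intro r hr
    have := hcon r hr
    have h2 : r ∈ ⋃ p ∈ associatedPrimes R (M ⧸ Gam 𝔪 M), (p : Set R) := by
      rw [biUnion_associatedPrimes_eq_zero_divisors]
      rw [isSMulRegular_iff_right_eq_zero_of_smul] at this
      push Not at this
      obtain ⟨x, hx, h0⟩ := this
      exact ⟨x, h0, hx⟩
    simpa using h2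
  rw [Ideal.subset_union_prime ⊥ ⊥] at hsub
  · obtain ⟨q, hq, hle⟩ := hsub
    simp only [Set.Finite.mem_toFinset, AssociatedPrimes.mem_iff, isAssociatedPrime_iff] at hq
    obtain ⟨hqp, x, hx⟩ := hq
    obtain ⟨y, rfl⟩ := Submodule.Quotient.mk_surjective _ x
    have hm : ∀ a ∈ 𝔪, a • y ∈ Gam 𝔪 M := by
      intro a ha
      have := hle ha
      change a ∈ q at this
      rw [hx, Submodule.mem_colon_singleton, Submodule.mem_bot, ← Submodule.Quotient.mk_smul, Submodule.Quotient.mk_eq_zero] at this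
      exact this
    obtain ⟨t, ht⟩ := Tors.fg 𝔪 (𝔪 • Submodule.span R {y})
      (IsNoetherian.noetherian _) (by
        rw [Submodule.smul_le]
        intro a ha z hz
        rw [Submodule.mem_span_singleton] at hz
        obtain ⟨b, rfl⟩ := hz
        rw [smul_comm]
        exact Submodule.smul_mem _ _ (hm a ha))
    have hy : y ∈ Gam 𝔪 M := by
      refine ⟨t + 1, fun r hr => ?_⟩
      rw [pow_succ] at hr
      induction hr using Submodule.mul_induction_on' with
      | mem_mul_mem a ha b hb =>
        rw [mul_smul]
        exact ht a ha _ (Submodule.smul_mem_smul hb (Submodule.mem_span_singleton_self y))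
      | add a _ b _ h1 h2 => rw [add_smul, h1, h2, add_zero]
    apply hqp.ne_top
    rw [hx, (Submodule.Quotient.mk_eq_zero _).2 hy]
    rw [Ideal.eq_top_iff_one, Submodule.mem_colon_singleton]
    simp
  · intro i hi _ _
    simp only [Set.Finite.mem_toFinset] at hi
    exact hi.1

lemma regLES (I : Ideal R) (N : Type u) [AddCommGroup N] [Module R N] (r : R) (hr : IsSMulRegular N r) (n : ℕ) :
   ∃ δ : LC I n (QuotSMulTop r N) →ₗ[R] LC I (n+1) N,
     (∀ z, Lmap I n (Submodule.mkQ _ : N →ₗ[R] QuotSMulTop r N) z = 0 → ∃ w, r • w = z) ∧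
      (∀ z, δ z = 0 → ∃ w, Lmap I n (Submodule.mkQ _ : N →ₗ[R] QuotSMulTop r N) w = z) ∧ (∀ z, r • z = 0 → ∃ w, δ w = z) ∧
      (∀ z, δ (Lmap I n (Submodule.mkQ _ : N →ₗ[R] QuotSMulTop r N) z) = 0) ∧ (∀ z, r • (δ z) = 0) := by
  have hsm : ∀ n z, Lmap I n (LinearMap.lsmul R N r) z = r • z := by
    intro n z
    have : LinearMap.lsmul R N r = r • LinearMap.id := by ext; simp
    rw [this, Lmap_smul, Lmap_id]
  have hex : Function.Exact (LinearMap.lsmul R N r) (Submodule.mkQ _ : N →ₗ[R] QuotSMulTop r N) := by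
    intro x
    simp [Submodule.mem_smul_pointwise_iff_exists]
  obtain ⟨δ, h1, h2, h3, h4, h5⟩ := LES I (LinearMap.lsmul R N r) (Submodule.mkQ _ : N →ₗ[R] QuotSMulTop r N) hr
    (Submodule.mkQ_surjective _) hex n
  simp only [hsm] at h1 h3 h5
  exact ⟨δ, h1, h2, h3, h4, h5⟩

lemma gam_inj (I : Ideal R) (M : Type u) [AddCommGroup M] [Module R M] (n : ℕ) :
    Function.Injective (Lmap I (n+1) (Gam I M).mkQ) := by
  obtain ⟨δ, h1, h2, h3, h4, h5⟩ := LES I (Gam I M).subtype (Gam I M).mkQ Subtype.val_injective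
    (Submodule.mkQ_surjective _) (LinearMap.exact_subtype_mkQ _) (n+1)
  rw [injective_iff_map_eq_zero]
  intro z hz
  obtain ⟨w, rfl⟩ := h1 z hz
  have := V0 I n (Gam I M) (Gam_tors I M)
  rw [Subsingleton.elim w 0, map_zero]

lemma tors_pow {I : Ideal R} {A : Type*} [AddCommGroup A] [Module R A] (h : Tors I A) (r : R) (hr : r ∈ I) (z : A) :
    ∃ k : ℕ, r ^ k • z = 0 := by
  obtain ⟨t, ht⟩ := h z
  exact ⟨t, ht _ (Ideal.pow_mem_pow hr t)⟩

lemma eq_zero_of_pow {A : Type*} [AddCommGroup A] [Module R A] (r : R) (h : ∀ z : A, r • z = 0 → z = 0) (k : ℕ) (z : A)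
    (hz : r ^ k • z = 0) : z = 0 := by
  induction k with
  | zero => simpa using hz
  | succ k ih => exact ih (h _ (by rwa [smul_smul, ← pow_succ']))

lemma dim_aux (a : WithBot ℕ∞) (n : ℕ) (h : a + 1 < ((n + 1 : ℕ) : WithBot ℕ∞)) : a < (n : WithBot ℕ∞) := by
  by_contra hc
  push Not at hc
  apply absurd h
  push Not
  push_cast
  gcongr

theorem V (n : ℕ) : ∀ (M : Type u) [AddCommGroup M] [Module R M] [Module.Finite R M],
    Module.supportDim R M < (n : WithBot ℕ∞) → Subsingleton (LC 𝔪 n M) := by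
  induction n with
  | zero =>
    intro M _ _ _ h
    have : Subsingleton M := by
      rw [← Module.supportDim_eq_bot_iff_subsingleton R]
      by_contra hc
      have hnt : Nontrivial M := (Module.supportDim_ne_bot_iff_nontrivial R M).1 hc
      apply absurd h
      push Not
      have : Nonempty (Module.support R M) := Module.nonempty_support_of_nontrivial.to_subtype
      exact Order.krullDim_nonneg
    exact LC_subsingleton _ _
  | succ n ih =>
    intro M _ _ _ h
    suffices Subsingleton (LC 𝔪 (n+1) (M ⧸ Gam 𝔪 M)) from (gam_inj 𝔪 M n).subsingleton
    obtain ⟨r, hr, hreg⟩ := exists_reg (R := R) M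
    obtain ⟨δ, h1, h2, h3, h4, h5⟩ := regLES 𝔪 _ r hreg n
    have hdim : Module.supportDim R (QuotSMulTop r (M ⧸ Gam 𝔪 M)) < (n : WithBot ℕ∞) := by
      apply dim_aux
      rw [Module.supportDim_quotSMulTop_succ_eq_supportDim hreg hr]
      exact (Module.supportDim_le_of_surjective _ (Submodule.mkQ_surjective _)).trans_lt h
    have := ih _ hdim
    apply subsing_of
    intro z
    obtain ⟨k, hk⟩ := tors_pow (LC_tors 𝔪 _) r hr z
    refine eq_zero_of_pow r (fun z hz => ?_) k z hk
    obtain ⟨w, rfl⟩ := h3 z hz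
    rw [Subsingleton.elim w 0, map_zero]

theorem Art (n : ℕ) : ∀ (M : Type u) [AddCommGroup M] [Module R M] [Module.Finite R M],
    IsArtinian R (LC 𝔪 n M) := by
  induction n with
  | zero =>
    intro M _ _ _
    obtain ⟨t, ht⟩ := Tors.fg 𝔪 (Gam 𝔪 M) (IsNoetherian.noetherian _) le_rfl
    have : IsArtinian R (Gam 𝔪 M) := art_of_killed _ t (fun r hr x => Subtype.ext (ht r hr x x.2))
    refine isArtinian_of_injective ((LCev 𝔪 (M := M)).codRestrict (Gam 𝔪 M) (fun z => ?_))
      (fun a b h => LCev_inj _ (congrArg Subtype.val h))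
    obtain ⟨s, hs⟩ := LC_tors 𝔪 0 z
    exact ⟨s, fun r hr => by rw [← map_smul, hs r hr, map_zero]⟩
  | succ n ih =>
    intro M _ _ _
    suffices IsArtinian R (LC 𝔪 (n+1) (M ⧸ Gam 𝔪 M)) from isArtinian_of_injective _ (gam_inj 𝔪 M n)
    obtain ⟨r, hr, hreg⟩ := exists_reg (R := R) M
    obtain ⟨δ, h1, h2, h3, h4, h5⟩ := regLES 𝔪 _ r hreg n
    have := ih (QuotSMulTop r (M ⧸ Gam 𝔪 M))
    have : IsArtinian R (LinearMap.range δ) := isArtinian_of_surjective _ δ.rangeRestrict δ.surjective_rangeRestrict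
    exact melkersson r (tors_pow (LC_tors 𝔪 _) r hr) (LinearMap.range δ) h3
end Loc


section Gen
variable {R : Type u} [CommRing R]

lemma dim_le_quot (M : Type*) [AddCommGroup M] [Module R M] [Module.Finite R M] (J : Ideal R)
    (h : J ≤ Module.annihilator R M) : Module.supportDim R M ≤ ringKrullDim (R ⧸ J) := by
  rw [Module.supportDim_eq_ringKrullDim_quotient_annihilator]
  exact ringKrullDim_le_of_surjective (Ideal.Quotient.factor h) (Ideal.Quotient.factor_surjective h)

lemma series_bound (M : Type*) [AddCommGroup M] [Module R M]
    (l : LTSeries (Module.support R M)) :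
    (l.length : WithBot ℕ∞) ≤ ringKrullDim (R ⧸ l.head.1.asIdeal) := by
  rw [ringKrullDim_quotient]
  let l' : LTSeries (PrimeSpectrum.zeroLocus (l.head.1.asIdeal : Set R)) :=
    { length := l.length
      toFun i := ⟨(l i).1, fun x hx => (LTSeries.head_le l i : l.head ≤ l i) hx⟩
      step i := l.step i }
  exact Order.le_krullDim_iff.2 ⟨l', rfl⟩

lemma quot_dim_le (M : Type*) [AddCommGroup M] [Module R M] (p : PrimeSpectrum R)
    (hp : p ∈ Module.support R M) : ringKrullDim (R ⧸ p.asIdeal) ≤ Module.supportDim R M := by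
  rw [ringKrullDim_quotient]
  refine Order.krullDim_le_of_strictMono (fun q => ⟨q.1, Module.mem_support_mono (q.2 : p ≤ q.1) hp⟩) ?_
  intro a b h
  exact h

lemma supportDim_eq (M : Type*) [AddCommGroup M] [Module R M] :
    Module.supportDim R M = ⨆ p ∈ Module.support R M, ringKrullDim (R ⧸ p.asIdeal) := by
  apply le_antisymm
  · refine iSup_le fun l => ?_
    exact (series_bound M l).trans (le_iSup₂_of_le l.head.1 l.head.2 le_rfl)
  · exact iSup₂_le fun p hp => quot_dim_le M p hp

lemma attain (M : Type*) [AddCommGroup M] [Module R M] (n : ℕ) (h : Module.supportDim R M = (n : WithBot ℕ∞)) :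
    ∃ p ∈ Module.support R M, ringKrullDim (R ⧸ p.asIdeal) = (n : WithBot ℕ∞) := by
  obtain ⟨l, hl⟩ := Order.le_krullDim_iff.1 h.ge
  refine ⟨l.head.1, l.head.2, le_antisymm ((quot_dim_le M _ l.head.2).trans h.le) ?_⟩
  have := series_bound M l
  rwa [hl] at this

lemma lt_succ_of_le' (a : WithBot ℕ∞) (n : ℕ) (h : a ≤ (n : WithBot ℕ∞)) : a < ((n + 1 : ℕ) : WithBot ℕ∞) := by
  refine h.trans_lt ?_
  exact_mod_cast Nat.lt_succ_self n

lemma QQ (M : Type u) [AddCommGroup M] [Module R M] [Module.Finite R M] (p : PrimeSpectrum R)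
    (hp : p ∈ Module.support R M) : ∃ K : Submodule R M, Nontrivial (M ⧸ K) ∧ p.asIdeal ≤ Module.annihilator R (M ⧸ K)
      ∧ ∀ r ∉ p.asIdeal, IsSMulRegular (M ⧸ K) r := by
  let K : Submodule R M :=
    { carrier := {x | ∃ s ∉ p.asIdeal, s • x ∈ p.asIdeal • (⊤ : Submodule R M)}
      zero_mem' := ⟨1, p.isPrime.one_notMem, by simp⟩
      add_mem' := by
        rintro a b ⟨s, hs, h⟩ ⟨t, ht, h'⟩
        refine ⟨s * t, fun hc => (p.isPrime.mem_or_mem hc).elim hs ht, ?_⟩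
        rw [smul_add]
        refine Submodule.add_mem _ ?_ ?_
        · rw [mul_comm, mul_smul]; exact Submodule.smul_mem _ _ h
        · rw [mul_smul]; exact Submodule.smul_mem _ _ h'
      smul_mem' := by
        rintro c x ⟨s, hs, h⟩
        exact ⟨s, hs, by rw [smul_comm]; exact Submodule.smul_mem _ _ h⟩ }
  have memK : ∀ x, x ∈ K ↔ ∃ s ∉ p.asIdeal, s • x ∈ p.asIdeal • (⊤ : Submodule R M) := fun x => Iff.rfl
  refine ⟨K, ?_, ?_, ?_⟩
  · rw [Submodule.Quotient.nontrivial_iff]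
    intro htop
    have h1 : p ∈ Module.support R (M ⧸ p.asIdeal • (⊤ : Submodule R M)) := by
      rw [Module.support_quotient]
      exact ⟨hp, fun x hx => hx⟩
    refine absurd h1 (Module.notMem_support_iff'.2 fun m => ?_)
    obtain ⟨x, rfl⟩ := Submodule.Quotient.mk_surjective _ m
    obtain ⟨s, hs, h⟩ := (memK x).1 (htop ▸ Submodule.mem_top)
    exact ⟨s, hs, by rwa [← Submodule.Quotient.mk_smul, Submodule.Quotient.mk_eq_zero]⟩
  · intro r hr
    rw [Module.mem_annihilator]
    intro m
    obtain ⟨x, rfl⟩ := Submodule.Quotient.mk_surjective _ m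
    rw [← Submodule.Quotient.mk_smul, Submodule.Quotient.mk_eq_zero]
    refine (memK _).2 ⟨1, p.isPrime.one_notMem, ?_⟩
    rw [one_smul]
    exact Submodule.smul_mem_smul hr Submodule.mem_top
  · intro r hr
    rw [isSMulRegular_iff_right_eq_zero_of_smul]
    intro m hm
    obtain ⟨x, rfl⟩ := Submodule.Quotient.mk_surjective _ m
    rw [← Submodule.Quotient.mk_smul, Submodule.Quotient.mk_eq_zero] at hm
    rw [Submodule.Quotient.mk_eq_zero]
    obtain ⟨s, hs, h⟩ := (memK _).1 hm
    refine (memK x).2 ⟨s * r, fun hc => (p.isPrime.mem_or_mem hc).elim hs hr, ?_⟩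
    rwa [mul_smul]

lemma ann_eq (N : Type*) [AddCommGroup N] [Module R N] [Nontrivial N] (p : Ideal R) (h : p ≤ Module.annihilator R N)
    (h' : ∀ r ∉ p, IsSMulRegular N r) : Module.annihilator R N = p := by
  refine le_antisymm (fun r hr => ?_) h
  by_contra hc
  obtain ⟨x, hx⟩ := exists_ne (0 : N)
  exact hx ((isSMulRegular_iff_right_eq_zero_of_smul).1 (h' r hc) x (Module.mem_annihilator.1 hr x))

/-- Artinian modules: sum-irreducible alternative. -/
lemma irr_alt {A : Type*} [AddCommGroup A] [Module R A] [IsArtinian R A] (B : Submodule R A)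
    (hB : ∀ B1 B2 : Submodule R A, B1 < B → B2 < B → ¬ B ≤ B1 ⊔ B2) (r : R) :
    (∀ z ∈ B, ∃ w ∈ B, z = r • w) ∨ ∃ t : ℕ, ∀ z ∈ B, r ^ t • z = 0 := by
  obtain ⟨n, hn⟩ := IsArtinian.monotone_stabilizes (R := R) (M := A)
    (⟨fun k => OrderDual.toDual (B.map (LinearMap.lsmul R A (r ^ k))), fun a b h => by
      change B.map (LinearMap.lsmul R A (r ^ b)) ≤ B.map (LinearMap.lsmul R A (r ^ a))
      rintro _ ⟨y, hy, rfl⟩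
      refine ⟨r ^ (b - a) • y, B.smul_mem _ hy, ?_⟩
      simp only [LinearMap.lsmul_apply, smul_smul, ← pow_add]
      congr 2; omega⟩ : ℕ →o (Submodule R A)ᵒᵈ)
  have h2 : ∀ y ∈ B, ∃ w ∈ B, r ^ (n + 1 + n) • w = r ^ n • y := by
    intro y hy
    have : B.map (LinearMap.lsmul R A (r ^ n)) = B.map (LinearMap.lsmul R A (r ^ (n + 1 + n))) := hn (n+1+n) (by omega)
    have h3 : r ^ n • y ∈ B.map (LinearMap.lsmul R A (r ^ n)) := ⟨y, hy, rfl⟩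
    rw [this] at h3
    exact h3
  by_contra! hcon
  obtain ⟨⟨z, hz, hzn⟩, hcon2⟩ := hcon
  refine hB (B.map (LinearMap.lsmul R A (r ^ (n+1)))) (B ⊓ LinearMap.ker (LinearMap.lsmul R A (r ^ n))) ?_ ?_ ?_
  · refine lt_of_le_of_ne ?_ ?_
    · rintro _ ⟨y, hy, rfl⟩
      exact B.smul_mem _ hy
    · intro e
      rw [← e] at hz
      obtain ⟨y, hy, e'⟩ := hz
      refine hzn (r ^ n • y) (B.smul_mem _ hy) ?_
      rw [← e', smul_smul, ← pow_succ']
      rfl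
  · refine lt_of_le_of_ne inf_le_left ?_
    intro e
    obtain ⟨y, hy, hy0⟩ := hcon2 n
    rw [← e] at hy
    exact hy0 hy.2
  · intro y hy
    obtain ⟨w, hw, e⟩ := h2 y hy
    have : y = r ^ (n+1) • w + (y - r ^ (n+1) • w) := by abel
    rw [this]
    refine Submodule.add_mem_sup ⟨w, hw, rfl⟩ ⟨B.sub_mem hy (B.smul_mem _ hw), ?_⟩
    change r ^ n • (y - r ^ (n+1) • w) = 0
    rw [smul_sub, smul_smul, ← pow_add, ← e, sub_eq_zero]
    congr 2; omega

lemma surj_pow {A : Type*} [AddCommGroup A] [Module R A] (B : Submodule R A) (r : R)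
    (h : ∀ z ∈ B, ∃ w ∈ B, z = r • w) (k : ℕ) : ∀ z ∈ B, ∃ w ∈ B, z = r ^ k • w := by
  induction k with
  | zero => exact fun z hz => ⟨z, hz, by simp⟩
  | succ k ih =>
    intro z hz
    obtain ⟨w, hw, e⟩ := ih z hz
    obtain ⟨v, hv, e'⟩ := h w hw
    exact ⟨v, hv, by rw [e, e', smul_smul, ← pow_succ]⟩

lemma irr_prime {A : Type*} [AddCommGroup A] [Module R A] [IsArtinian R A] (B : Submodule R A) (hB0 : B ≠ ⊥)
    (hB : ∀ B1 B2 : Submodule R A, B1 < B → B2 < B → ¬ B ≤ B1 ⊔ B2) : B.annihilator.radical.IsPrime := by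
  refine ⟨?_, ?_⟩
  · intro e
    rw [Ideal.radical_eq_top, Ideal.eq_top_iff_one, Submodule.mem_annihilator] at e
    exact hB0 ((Submodule.eq_bot_iff _).2 fun x hx => by simpa using e x hx)
  · intro a b hab
    rcases irr_alt B hB a with h | ⟨t, ht⟩
    · right
      obtain ⟨k, hk⟩ := hab
      refine ⟨k, ?_⟩
      rw [Submodule.mem_annihilator] at hk ⊢
      intro z hz
      obtain ⟨w, hw, rfl⟩ := surj_pow B a h k z hz
      have := hk w hw
      rwa [mul_comm, mul_pow, mul_smul] at this
    · left
      exact ⟨t, Submodule.mem_annihilator.2 ht⟩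

end Gen

section Loc
variable {R : Type u} [CommRing R] [IsNoetherianRing R] [IsLocalRing R]
local notation "𝔪" => IsLocalRing.maximalIdeal R

lemma DA {A : Type*} [AddCommGroup A] [Module R A] [IsArtinian R A] (B : Submodule R A) :
    ∃ S : Finset (Ideal R), (∀ q ∈ S, q.IsPrime ∧ q ≠ 𝔪) ∧ ∀ r : R, (∀ q ∈ S, r ∉ q) →
      ∃ t : ℕ, ∀ a ∈ 𝔪 ^ t, ∀ z ∈ B, ∃ w ∈ B, a • z = r • w := by
  classical
  induction B using WellFoundedLT.induction with
  | ind B ih =>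
  by_cases hB0 : B = ⊥
  · refine ⟨∅, by simp, fun r _ => ⟨0, fun a _ z hz => ⟨0, zero_mem _, ?_⟩⟩⟩
    rw [hB0, Submodule.mem_bot] at hz
    rw [hz, smul_zero, smul_zero]
  by_cases hB : ∀ B1 B2 : Submodule R A, B1 < B → B2 < B → ¬ B ≤ B1 ⊔ B2
  · have hq := irr_prime B hB0 hB
    by_cases hm : B.annihilator.radical = 𝔪
    · obtain ⟨t, ht⟩ := Ideal.exists_radical_pow_le_of_fg B.annihilator (IsNoetherian.noetherian _)
      rw [hm] at ht
      refine ⟨∅, by simp, fun r _ => ⟨t, fun a ha z hz => ⟨0, zero_mem _, ?_⟩⟩⟩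
      rw [smul_zero]
      exact Submodule.mem_annihilator.1 (ht ha) z hz
    · refine ⟨{B.annihilator.radical}, by simp [hq, hm], fun r hr => ⟨0, fun a _ z hz => ?_⟩⟩
      rcases irr_alt B hB r with h | ⟨t, ht⟩
      · exact h _ (B.smul_mem a hz)
      · exact absurd ⟨t, Submodule.mem_annihilator.2 ht⟩ (hr _ (Finset.mem_singleton_self _))
  · push Not at hB
    obtain ⟨B1, B2, h1, h2, h⟩ := hB
    obtain ⟨S1, hS1, hr1⟩ := ih B1 h1
    obtain ⟨S2, hS2, hr2⟩ := ih B2 h2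
    refine ⟨S1 ∪ S2, fun q hq => (Finset.mem_union.1 hq).elim (hS1 q) (hS2 q), fun r hr => ?_⟩
    obtain ⟨t1, ht1⟩ := hr1 r (fun q hq => hr q (Finset.mem_union_left _ hq))
    obtain ⟨t2, ht2⟩ := hr2 r (fun q hq => hr q (Finset.mem_union_right _ hq))
    refine ⟨max t1 t2, fun a ha z hz => ?_⟩
    obtain ⟨y1, hy1, y2, hy2, rfl⟩ := Submodule.mem_sup.1 (h hz)
    obtain ⟨w1, hw1, e1⟩ := ht1 a (Ideal.pow_le_pow_right (le_max_left _ _) ha) y1 hy1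
    obtain ⟨w2, hw2, e2⟩ := ht2 a (Ideal.pow_le_pow_right (le_max_right _ _) ha) y2 hy2
    exact ⟨w1 + w2, B.add_mem (h1.le hw1) (h2.le hw2), by rw [smul_add, smul_add, e1, e2]⟩

theorem RE (n : ℕ) {M N : Type u} [AddCommGroup M] [Module R M] [Module.Finite R M] [AddCommGroup N] [Module R N]
    (h : Module.supportDim R M ≤ (n : WithBot ℕ∞)) (g : M →ₗ[R] N) (hg : Function.Surjective g) :
    Function.Surjective (Lmap 𝔪 n g) := by
  obtain ⟨δ, h1, h2, h3, h4, h5⟩ := LES 𝔪 (LinearMap.ker g).subtype g Subtype.val_injective hg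
    (LinearMap.exact_subtype_ker_map g) n
  have := V (n+1) (LinearMap.ker g) (lt_succ_of_le' _ _
    ((Module.supportDim_le_of_injective (LinearMap.ker g).subtype Subtype.val_injective).trans h))
  intro z
  exact h2 z (Subsingleton.elim _ _)

theorem IQ (n : ℕ) {M : Type u} [AddCommGroup M] [Module R M] [Module.Finite R M]
    (h : Module.supportDim R M ≤ (n : WithBot ℕ∞)) (J : Ideal R)
    (hJ : Subsingleton (LC 𝔪 n (M ⧸ J • (⊤ : Submodule R M)))) (P : Submodule R (LC 𝔪 n M))
    (hP : ∀ v ∈ J, ∀ z, v • z ∈ P) (z : LC 𝔪 n M) : z ∈ P := by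
  classical
  obtain ⟨S, hS⟩ := IsNoetherian.noetherian J
  let φ : (S → M) →ₗ[R] M := ∑ i : S, (i : R) • LinearMap.proj i
  have hφ : ∀ x, φ x = ∑ i : S, (i : R) • x i := fun x => by simp [φ]
  have hmem : ∀ x, φ x ∈ J • (⊤ : Submodule R M) := by
    intro x
    rw [hφ]
    refine Submodule.sum_mem _ fun i _ => Submodule.smul_mem_smul ?_ Submodule.mem_top
    rw [← hS]
    exact Submodule.subset_span i.2
  let φ' : (S → M) →ₗ[R] (J • (⊤ : Submodule R M) : Submodule R M) := φ.codRestrict _ hmem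
  have hsurj : Function.Surjective φ' := by
    have : J • (⊤ : Submodule R M) ≤ LinearMap.range φ := by
      rw [Submodule.smul_le]
      intro a ha x _
      rw [← hS] at ha
      induction ha using Submodule.span_induction with
      | mem a ha =>
        refine ⟨Pi.single ⟨a, ha⟩ x, ?_⟩
        rw [hφ, Finset.sum_eq_single ⟨a, ha⟩]
        · simp
        · intro b _ hb
          rw [Pi.single_eq_of_ne hb, smul_zero]
        · simp
      | zero => rw [zero_smul]; exact zero_mem _
      | add a b _ _ h1 h2 => rw [add_smul]; exact add_mem h1 h2
      | smul c a _ h1 => rw [smul_assoc]; exact Submodule.smul_mem _ _ h1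
    rintro ⟨y, hy⟩
    obtain ⟨x, hx⟩ := this hy
    exact ⟨x, Subtype.ext hx⟩
  have hd : Module.supportDim R (S → M) ≤ (n : WithBot ℕ∞) := by
    refine le_trans (dim_le_quot (S → M) (Module.annihilator R M) ?_)
      ((Module.supportDim_eq_ringKrullDim_quotient_annihilator R M).symm.le.trans h)
    intro r hr
    rw [Module.mem_annihilator] at hr ⊢
    intro x
    funext i
    exact hr _
  obtain ⟨δ, h1, -⟩ := LES 𝔪 (J • (⊤ : Submodule R M)).subtype (J • (⊤ : Submodule R M)).mkQ Subtype.val_injective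
    (Submodule.mkQ_surjective _) (LinearMap.exact_subtype_mkQ _) n
  obtain ⟨w, rfl⟩ := h1 z (Subsingleton.elim _ _)
  obtain ⟨v, rfl⟩ := RE n hd φ' hsurj w
  have e : (J • (⊤ : Submodule R M)).subtype ∘ₗ φ' = φ := rfl
  rw [← Lmap_comp, e]
  simp only [φ]
  rw [Lmap_sum]
  refine Submodule.sum_mem _ fun i _ => ?_
  rw [Lmap_smul]
  refine hP _ ?_ _
  rw [← hS]
  exact Submodule.subset_span i.2

end Loc

section Loc
variable {R : Type u} [CommRing R] [IsNoetherianRing R] [IsLocalRing R]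
local notation "𝔪" => IsLocalRing.maximalIdeal R

lemma gam_ne (M : Type u) [AddCommGroup M] [Module R M] [Module.Finite R M] (h : Module.supportDim R M = 0) :
    Nontrivial (LC 𝔪 0 M) := by
  have hnt : Nontrivial M := (Module.supportDim_ne_bot_iff_nontrivial R M).1 (by rw [h]; exact WithBot.zero_ne_bot)
  have hs := support_of_supportDim_eq_zero R M h
  obtain ⟨q, hq⟩ := associatedPrimes.nonempty R M
  obtain ⟨hqp, x, hx⟩ := isAssociatedPrime_iff.1 hq
  have hmem : (⟨q, hqp⟩ : PrimeSpectrum R) ∈ Module.support R M := by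
    rw [Module.mem_support_iff_of_finite]
    intro r hr
    change r ∈ q
    rw [hx, Submodule.mem_colon_singleton, Submodule.mem_bot]
    exact Module.mem_annihilator.1 hr x
  rw [hs] at hmem
  obtain ⟨z, hz⟩ := LCev_range 𝔪 x 1 (fun r hr => by
    rw [pow_one] at hr
    have : r ∈ q := hmem hr
    rwa [hx, Submodule.mem_colon_singleton, Submodule.mem_bot] at this)
  refine ⟨⟨z, 0, ?_⟩⟩
  rintro rfl
  apply hqp.ne_top
  rw [hx, ← hz, map_zero, Ideal.eq_top_iff_one, Submodule.mem_colon_singleton]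
  simp

lemma quot_ann (M : Type*) [AddCommGroup M] [Module R M] (J : Ideal R) :
    J ≤ Module.annihilator R (M ⧸ J • (⊤ : Submodule R M)) := by
  intro r hr
  rw [Module.mem_annihilator]
  intro m
  obtain ⟨x, rfl⟩ := Submodule.Quotient.mk_surjective _ m
  rw [← Submodule.Quotient.mk_smul, Submodule.Quotient.mk_eq_zero]
  exact Submodule.smul_mem_smul hr Submodule.mem_top

lemma ringDim_m : ringKrullDim (R ⧸ 𝔪) = 0 := by
  letI := Ideal.Quotient.field 𝔪
  exact ringKrullDim_eq_zero_of_field _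

lemma cancel_succ (a : WithBot ℕ∞) (n : ℕ) (h : a + 1 = ((n + 1 : ℕ) : WithBot ℕ∞)) : a = (n : WithBot ℕ∞) := by
  induction a with
  | bot => exact absurd h (by rw [WithBot.bot_add]; exact WithBot.bot_ne_natCast _)
  | coe a =>
    induction a with
    | top => exact absurd h (by norm_cast; rw [top_add]; exact ENat.top_ne_natCast _)
    | coe a =>
      norm_cast at h ⊢
      omega

/-- a finite set of primes different from the maximal ideal can be avoided -/
lemma avoid (S : Finset (Ideal R)) (hS : ∀ q ∈ S, q.IsPrime ∧ q ≠ 𝔪) : ∃ r ∈ 𝔪, ∀ q ∈ S, r ∉ q := by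
  by_contra! hcon
  have hsub : (𝔪 : Set R) ⊆ ⋃ i ∈ (S : Set (Ideal R)), (id i : Ideal R) := by
    intro r hr
    obtain ⟨q, hq, h⟩ := hcon r hr
    exact Set.mem_biUnion hq h
  obtain ⟨q, hq, hle⟩ := (Ideal.subset_union_prime (f := id) ⊥ ⊥ (fun i hi _ _ => (hS i hi).1)).1 hsub
  have := (hS q hq).1
  exact (hS q hq).2 (le_antisymm (IsLocalRing.le_maximalIdeal this.ne_top) hle)

theorem NV (n : ℕ) : ∀ (M : Type u) [AddCommGroup M] [Module R M] [Module.Finite R M],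
    Module.supportDim R M = (n : WithBot ℕ∞) → Nontrivial (LC 𝔪 n M) := by
  classical
  induction n with
  | zero =>
    intro M _ _ _ h
    exact gam_ne M (by simpa using h)
  | succ n ih =>
    intro M _ _ _ h
    obtain ⟨p, hp, hpd⟩ := attain M (n+1) h
    obtain ⟨K, hnt, hK1, hK2⟩ := QQ M p hp
    suffices Nontrivial (LC 𝔪 (n+1) (M ⧸ K)) from
      (RE (n+1) h.le K.mkQ (Submodule.mkQ_surjective _)).nontrivial
    have hann := ann_eq _ _ hK1 hK2
    have hNd : Module.supportDim R (M ⧸ K) = ((n+1 : ℕ) : WithBot ℕ∞) := by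
      rw [Module.supportDim_eq_ringKrullDim_quotient_annihilator, hann, hpd]
    have hpm : p.asIdeal ≠ 𝔪 := by
      intro e
      rw [e, ringDim_m] at hpd
      norm_cast at hpd
    by_contra hc
    rw [not_nontrivial_iff_subsingleton] at hc
    have hart : IsArtinian R (LC 𝔪 n (M ⧸ K)) := Art n _
    obtain ⟨S, hS, hSr⟩ := DA (R := R) (⊤ : Submodule R (LC 𝔪 n (M ⧸ K)))
    obtain ⟨r, hrm, hr⟩ := avoid (insert p.asIdeal S) (fun q hq => by
      rcases Finset.mem_insert.1 hq with rfl | hq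
      · exact ⟨p.isPrime, hpm⟩
      · exact hS q hq)
    have hrp : r ∉ p.asIdeal := hr _ (Finset.mem_insert_self _ _)
    have hreg := hK2 r hrp
    obtain ⟨δ, h1, h2, h3, h4, h5⟩ := regLES 𝔪 (M ⧸ K) r hreg n
    have hBd : Module.supportDim R (QuotSMulTop r (M ⧸ K)) = (n : WithBot ℕ∞) := by
      apply cancel_succ
      rw [Module.supportDim_quotSMulTop_succ_eq_supportDim hreg hrm, hNd]
    have hB := ih _ hBd
    have hsurj : ∀ z, ∃ w, Lmap 𝔪 n (Submodule.mkQ _ : (M ⧸ K) →ₗ[R] QuotSMulTop r (M ⧸ K)) w = z :=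
      fun z => h2 z (Subsingleton.elim _ _)
    have hker : ∀ w, Lmap 𝔪 n (Submodule.mkQ _ : (M ⧸ K) →ₗ[R] QuotSMulTop r (M ⧸ K)) (r • w) = 0 := by
      intro w
      have e : r • (Submodule.mkQ _ : (M ⧸ K) →ₗ[R] QuotSMulTop r (M ⧸ K)) = 0 := by
        refine LinearMap.ext fun x => ?_
        change Submodule.Quotient.mk (r • x) = _
        exact (Submodule.Quotient.mk_eq_zero _).2 (Submodule.smul_mem_pointwise_smul _ _ _ Submodule.mem_top)
      rw [map_smul, ← Lmap_smul, e, Lmap_zero]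
    refine not_subsingleton (LC 𝔪 n (QuotSMulTop r (M ⧸ K))) (subsing_of fun z => ?_)
    rcases n with _ | n
    · obtain ⟨w, rfl⟩ := hsurj z
      obtain ⟨k, hk⟩ := tors_pow (LC_tors 𝔪 0) r hrm w
      have hw : LCev 𝔪 w = 0 := eq_zero_of_pow r (isSMulRegular_iff_right_eq_zero_of_smul.1 hreg) k _
        (by rw [← map_smul, hk, map_zero])
      have hw0 : w = 0 := LCev_inj 𝔪 (by rw [hw, map_zero])
      rw [hw0, map_zero]
    · obtain ⟨t, ht⟩ := hSr r (fun q hq => hr q (Finset.mem_insert_of_mem hq))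
      have hJ : Subsingleton (LC 𝔪 (n+1) (QuotSMulTop r (M ⧸ K) ⧸
          (𝔪 ^ t • (⊤ : Submodule R (QuotSMulTop r (M ⧸ K)))))) :=
        V0 𝔪 n _ (fun x => ⟨t, fun a ha => Module.mem_annihilator.1 (quot_ann _ _ ha) x⟩)
      have := IQ (n+1) hBd.le (𝔪 ^ t) hJ ⊥ (fun a ha y => by
        obtain ⟨w, rfl⟩ := hsurj y
        obtain ⟨w', -, e⟩ := ht a ha w Submodule.mem_top
        rw [← map_smul, e, hker]
        exact zero_mem _) z
      exact this

theorem main (M : Type u) [AddCommGroup M] [Module R M] [Module.Finite R M] (d : ℕ)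
    (hd : Module.supportDim R M = (d : WithBot ℕ∞)) (p : Ideal R) (hp : p.IsPrime) :
    (∃ N : Submodule R (LC 𝔪 d M), Module.annihilator R (LC 𝔪 d M ⧸ N) = p) ↔
      ((⟨p, hp⟩ : PrimeSpectrum R) ∈ Module.support R M ∧ ringKrullDim (R ⧸ p) = (d : WithBot ℕ∞)) := by
  constructor
  · rintro ⟨N, hN⟩
    have hsupp : (⟨p, hp⟩ : PrimeSpectrum R) ∈ Module.support R M := by
      rw [Module.mem_support_iff_of_finite]
      intro r hr
      change r ∈ p
      rw [← hN, Module.mem_annihilator]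
      intro m
      obtain ⟨x, rfl⟩ := Submodule.Quotient.mk_surjective _ m
      have e : r • x = 0 := by
        rw [← Lmap_id 𝔪 d x, ← Lmap_smul]
        have : r • (LinearMap.id : M →ₗ[R] M) = 0 := LinearMap.ext fun y => Module.mem_annihilator.1 hr y
        rw [this, Lmap_zero]
      rw [← Submodule.Quotient.mk_smul, e, Submodule.Quotient.mk_zero]
    refine ⟨hsupp, ?_⟩
    by_contra hne
    have hlt : ringKrullDim (R ⧸ p) < (d : WithBot ℕ∞) :=
      lt_of_le_of_ne ((quot_dim_le M _ hsupp).trans hd.le) hne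
    have hJ := V d (M ⧸ p • (⊤ : Submodule R M)) ((dim_le_quot _ p (quot_ann _ _)).trans_lt hlt)
    have hall := IQ d hd.le p hJ N (fun v hv z => by
      rw [← hN, Module.mem_annihilator] at hv
      have := hv (Submodule.Quotient.mk z)
      rwa [← Submodule.Quotient.mk_smul, Submodule.Quotient.mk_eq_zero] at this)
    apply hp.ne_top
    rw [← hN, Ideal.eq_top_iff_one, Module.mem_annihilator]
    intro m
    obtain ⟨x, rfl⟩ := Submodule.Quotient.mk_surjective _ m
    rw [one_smul, Submodule.Quotient.mk_eq_zero]
    exact hall x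
  · rintro ⟨hsupp, hdim⟩
    obtain ⟨K, hnt, hK1, hK2⟩ := QQ M _ hsupp
    have hann := ann_eq _ _ hK1 hK2
    have hNd : Module.supportDim R (M ⧸ K) = (d : WithBot ℕ∞) := by
      rw [Module.supportDim_eq_ringKrullDim_quotient_annihilator, hann, hdim]
    have hL := NV d (M ⧸ K) hNd
    have hs := RE d hd.le K.mkQ (Submodule.mkQ_surjective _)
    refine ⟨LinearMap.ker (Lmap 𝔪 d K.mkQ), ?_⟩
    rw [((Lmap 𝔪 d K.mkQ).quotKerEquivOfSurjective hs).annihilator_eq]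
    refine le_antisymm (fun r hr => ?_) (fun r hr => ?_)
    · by_contra hrp
      rw [Module.mem_annihilator] at hr
      have hreg := hK2 r hrp
      refine not_subsingleton (LC 𝔪 d (M ⧸ K)) (subsing_of fun z => ?_)
      by_cases hrm : r ∈ 𝔪
      · obtain ⟨δ, h1, -⟩ := regLES 𝔪 (M ⧸ K) r hreg d
        have hlt : Module.supportDim R (QuotSMulTop r (M ⧸ K)) < (d : WithBot ℕ∞) := by
          apply dim_aux
          rw [Module.supportDim_quotSMulTop_succ_eq_supportDim hreg hrm]
          exact lt_succ_of_le' _ _ hNd.le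
        have := V d _ hlt
        obtain ⟨w, rfl⟩ := h1 z (Subsingleton.elim _ _)
        exact hr w
      · have hu : IsUnit r := by
          rw [IsLocalRing.mem_maximalIdeal, mem_nonunits_iff, not_not] at hrm
          exact hrm
        exact (hu.smul_eq_zero).1 (hr z)
    · rw [Module.mem_annihilator]
      intro z
      rw [← Lmap_id 𝔪 d z, ← Lmap_smul]
      have : r • (LinearMap.id : (M ⧸ K) →ₗ[R] (M ⧸ K)) = 0 :=
        LinearMap.ext fun y => Module.mem_annihilator.1 (hK1 hr) y
      rw [this, Lmap_zero]

lemma att_congr {A B : Type*} [AddCommGroup A] [Module R A] [AddCommGroup B] [Module R B] (e : A ≃ₗ[R] B) (p : Ideal R)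
    (h : ∃ N : Submodule R A, Module.annihilator R (A ⧸ N) = p) :
    ∃ N : Submodule R B, Module.annihilator R (B ⧸ N) = p := by
  obtain ⟨N, hN⟩ := h
  refine ⟨N.map (e : A →ₗ[R] B), ?_⟩
  rw [← hN]
  exact (Submodule.Quotient.equiv N _ e rfl).annihilator_eq.symm
end Loc


end TopLC

/-- over a complete Noetherian local ring (which admits a normalized
dualizing complex), `Att_R (H^d_m(M)) = Assh_R M` for `M` finitely generated of
dimension `d`. -/
theorem attachedPrimes_top_localCohomology (R : Type u) [CommRing R] [IsNoetherianRing R]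
    [IsLocalRing R] [IsAdicComplete (IsLocalRing.maximalIdeal R) R]
    (M : Type u) [AddCommGroup M] [Module R M] [Module.Finite R M]
    (d : ℕ) (hd : moduleDim R M = (d : ℕ∞)) :
    attachedPrimes R
        ((localCohomology (IsLocalRing.maximalIdeal R) d).obj (ModuleCat.of R M)) =
      asshIdeals R M := by
  have hsd : Module.supportDim R M = (d : WithBot ℕ∞) := by
    rw [TopLC.supportDim_eq]
    exact hd
  have hm : moduleDim R M = (d : WithBot ℕ∞) := hd
  ext p
  constructor
  · rintro ⟨hp, h⟩
    have := (TopLC.main M d hsd p hp).1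
      (TopLC.att_congr (TopLC.LCequiv (IsLocalRing.maximalIdeal R) d M).symm p h)
    exact ⟨hp, this.1, this.2.trans hm.symm⟩
  · rintro ⟨hp, h1, h2⟩
    exact ⟨hp, TopLC.att_congr (TopLC.LCequiv (IsLocalRing.maximalIdeal R) d M) p
      ((TopLC.main M d hsd p hp).2 ⟨h1, h2.trans hm⟩)⟩
end
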